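/- arXiv:2603.06109 — 9 statements merged into one kernel-verified Lean document; each statement's English description precedes it below -/
import Mathlib

section
/- For all positive integers n < k and every real m ≥ 0, the following two-sided estimate holds: (1/(2(m+1)))·(ln(k/n))^{m+1} ≤ Σ_{i=n+1}^{k} (ln(i/n))^{m}/i ≤ (2^{m+2}/(m+1))·(ln(k/n))^{m+1}. -/
/-- The power function `t ↦ t ^ (m + 1)` lies above its tangent line at `x`. -/
theorem rpow_add_one_tangent_le {m x y : ℝ} (hm : 0 ≤ m) (hx : 0 < x) (hy : 0 ≤ y) :
    x ^ (m + 1) + (m + 1) * x ^ m * (y - x) ≤ y ^ (m + 1) := by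
  have hs : -1 ≤ y / x - 1 := by linarith [div_nonneg hy hx.le]
  have h := one_add_mul_self_le_rpow_one_add hs (p := m + 1) (by linarith)
  rw [add_sub_cancel, Real.div_rpow hy hx.le, le_div_iff₀ (Real.rpow_pos_of_pos hx _)] at h
  refine le_of_eq_of_le ?_ h
  rw [Real.rpow_add_one hx.ne']
  field_simp

theorem log_succ_div_sub_log_div {n i : ℕ} (hn : 0 < n) (hi : 0 < i) :
    Real.log (((i + 1 : ℕ) : ℝ) / n) - Real.log ((i : ℝ) / n) =
      Real.log (((i + 1 : ℕ) : ℝ) / i) := by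
  rw [Real.log_div (by positivity) (by positivity), Real.log_div (by positivity) (by positivity),
    Real.log_div (by positivity) (by positivity)]
  ring

theorem inv_succ_le_log_succ_div {i : ℕ} (hi : 0 < i) :
    1 / ((i + 1 : ℕ) : ℝ) ≤ Real.log (((i + 1 : ℕ) : ℝ) / i) := by
  have h := Real.one_sub_inv_le_log_of_pos (x := ((i + 1 : ℕ) : ℝ) / i) (by positivity)
  refine le_of_eq_of_le ?_ h
  push_cast
  field_simp
  ring

theorem log_succ_div_le_two_div_succ {i : ℕ} (hi : 0 < i) :
    Real.log (((i + 1 : ℕ) : ℝ) / i) ≤ 2 / ((i + 1 : ℕ) : ℝ) := by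
  have h := Real.log_le_sub_one_of_pos (x := ((i + 1 : ℕ) : ℝ) / i) (by positivity)
  have hi' : (1 : ℝ) ≤ i := by exact_mod_cast hi
  refine h.trans ?_
  rw [div_sub_one (by positivity), div_le_div_iff₀ (by positivity) (by positivity)]
  push_cast
  nlinarith

theorem log_succ_div_le_two_mul_log_div {n i : ℕ} (hn : 0 < n) (hi : n < i) :
    Real.log (((i + 1 : ℕ) : ℝ) / n) ≤ 2 * Real.log ((i : ℝ) / n) := by
  have hi0 : 0 < i := hn.trans hi
  have hn' : (0 : ℝ) < n := by exact_mod_cast hn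
  have hi' : (n : ℝ) + 1 ≤ i := by exact_mod_cast hi
  have h : 2 * Real.log ((i : ℝ) / n) = Real.log (((i : ℝ) / n) ^ 2) := by
    rw [Real.log_pow]
    norm_num
  rw [h]
  apply Real.log_le_log (by positivity)
  rw [div_pow, div_le_div_iff₀ (by positivity) (by positivity)]
  push_cast
  nlinarith [mul_nonneg hn'.le (show (0 : ℝ) ≤ i * (i - n) - n by nlinarith)]

theorem log_natCast_div_pos {n i : ℕ} (hn : 0 < n) (hi : n < i) :
    0 < Real.log ((i : ℝ) / n) := by
  apply Real.log_pos
  rw [one_lt_div (by positivity)]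
  exact_mod_cast hi

theorem rpow_log_le_sum_rpow_log_div {n k : ℕ} (hn : 0 < n) (hnk : n ≤ k) {m : ℝ}
    (hm : 0 ≤ m) :
    (1 / (2 * (m + 1))) * (Real.log ((k : ℝ) / n)) ^ (m + 1) ≤
      ∑ i ∈ Finset.Icc (n + 1) k, (Real.log ((i : ℝ) / n)) ^ m / (i : ℝ) := by
  induction k, hnk using Nat.le_induction with
  | base =>
    have hn' : (n : ℝ) ≠ 0 := by positivity
    have hm' : m + 1 ≠ 0 := by positivity
    simp [div_self hn', Real.zero_rpow hm']
  | succ i hi ih =>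
    rw [Finset.sum_Icc_succ_top (by omega)]
    have hi0 : 0 < i := by omega
    have hb := log_natCast_div_pos hn (Nat.lt_succ_of_le hi)
    have ha : 0 ≤ Real.log ((i : ℝ) / n) := by
      apply Real.log_nonneg
      rw [one_le_div (by positivity)]
      exact_mod_cast hi
    have ht := rpow_add_one_tangent_le hm hb ha
    have hd := log_succ_div_le_two_div_succ hi0
    rw [← log_succ_div_sub_log_div hn hi0] at hd
    set a := Real.log ((i : ℝ) / n)
    set b := Real.log (((i + 1 : ℕ) : ℝ) / n)
    have hp : 0 ≤ (m + 1) * b ^ m := by positivity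
    have hmul := mul_le_mul_of_nonneg_left hd hp
    calc 1 / (2 * (m + 1)) * b ^ (m + 1)
        ≤ 1 / (2 * (m + 1)) * (a ^ (m + 1) + (m + 1) * b ^ m * (2 / ((i + 1 : ℕ) : ℝ))) := by
          gcongr
          linarith
      _ = 1 / (2 * (m + 1)) * a ^ (m + 1) + b ^ m / ((i + 1 : ℕ) : ℝ) := by
          field_simp
      _ ≤ _ := by gcongr

theorem sum_rpow_log_div_le_rpow_log {n k : ℕ} (hn : 0 < n) (hnk : n < k) {m : ℝ}
    (hm : 0 ≤ m) :
    ∑ i ∈ Finset.Icc (n + 1) k, (Real.log ((i : ℝ) / n)) ^ m / (i : ℝ) ≤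
      ((2 : ℝ) ^ (m + 2) / (m + 1)) * (Real.log ((k : ℝ) / n)) ^ (m + 1) := by
  induction k, hnk using Nat.le_induction with
  | base =>
    have hb := log_natCast_div_pos hn (Nat.lt_succ_self n)
    have hd := inv_succ_le_log_succ_div hn
    have hc : 1 ≤ (2 : ℝ) ^ (m + 2) / (m + 1) := by
      rw [one_le_div (by positivity)]
      have h := one_add_mul_self_le_rpow_one_add (s := 1) (p := m + 2) (by norm_num) (by linarith)
      norm_num at h
      linarith
    simp only [Nat.succ_eq_add_one, Finset.Icc_self, Finset.sum_singleton] at hb ⊢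
    set b := Real.log (((n + 1 : ℕ) : ℝ) / n)
    calc b ^ m / ((n + 1 : ℕ) : ℝ) = b ^ m * (1 / ((n + 1 : ℕ) : ℝ)) := by ring
      _ ≤ b ^ m * b := by gcongr
      _ = 1 * b ^ (m + 1) := by rw [Real.rpow_add_one hb.ne', one_mul]
      _ ≤ _ := by gcongr
  | succ i hi ih =>
    have hni : n < i := hi
    have hi0 : 0 < i := by omega
    rw [Finset.sum_Icc_succ_top (by omega)]
    have ha := log_natCast_div_pos hn hni
    have hb := log_natCast_div_pos hn (hni.trans (Nat.lt_succ_self i))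
    have ht := rpow_add_one_tangent_le hm ha hb.le
    have hd := inv_succ_le_log_succ_div hi0
    rw [← log_succ_div_sub_log_div hn hi0] at hd
    have h2 := log_succ_div_le_two_mul_log_div hn hni
    simp only [Nat.succ_eq_add_one] at hb ht
    set a := Real.log ((i : ℝ) / n)
    set b := Real.log (((i + 1 : ℕ) : ℝ) / n)
    have hab : 0 ≤ b - a := le_trans (by positivity) hd
    have hterm : b ^ m / ((i + 1 : ℕ) : ℝ) ≤
        (2 : ℝ) ^ (m + 2) / (m + 1) * (b ^ (m + 1) - a ^ (m + 1)) :=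
      calc b ^ m / ((i + 1 : ℕ) : ℝ) = b ^ m * (1 / ((i + 1 : ℕ) : ℝ)) := by ring
        _ ≤ (2 * a) ^ m * (b - a) := by gcongr
        _ = (2 : ℝ) ^ m / (m + 1) * ((m + 1) * a ^ m * (b - a)) := by
            rw [Real.mul_rpow zero_le_two ha.le]
            field_simp
        _ ≤ (2 : ℝ) ^ (m + 2) / (m + 1) * ((m + 1) * a ^ m * (b - a)) := by
            gcongr
            · norm_num
            · linarith
        _ ≤ _ := by
            gcongr
            linarith
    linarith


/-- For all positive integers `n < k` and every real `m ≥ 0`,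
`(1/(2(m+1)))·(ln(k/n))^{m+1} ≤ Σ_{i=n+1}^{k} (ln(i/n))^m / i ≤ (2^{m+2}/(m+1))·(ln(k/n))^{m+1}`. -/
theorem stmt_0 (n k : ℕ) (hn : 0 < n) (hnk : n < k) (m : ℝ) (hm : 0 ≤ m) :
    (1 / (2 * (m + 1))) * (Real.log ((k : ℝ) / n)) ^ (m + 1) ≤
      ∑ i ∈ Finset.Icc (n + 1) k, (Real.log ((i : ℝ) / n)) ^ m / (i : ℝ) ∧
    ∑ i ∈ Finset.Icc (n + 1) k, (Real.log ((i : ℝ) / n)) ^ m / (i : ℝ) ≤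
      ((2 : ℝ) ^ (m + 2) / (m + 1)) * (Real.log ((k : ℝ) / n)) ^ (m + 1) := by
  exact ⟨rpow_log_le_sum_rpow_log_div hn hnk.le hm, sum_rpow_log_div_le_rpow_log hn hnk hm⟩
end

section
/- Let β ≥ 0 and let ψ : ℤ⁺ → ℝ be a non-negative sequence such that there is a constant c > 0 with Σ_{k=1}^{n} ψ(k) ≤ c·Σ_{k=n}^{2n} ψ(k) for all n ∈ ℤ⁺. Then n^β·Σ_{k=1}^{n} ψ(k) ≤ (4^β c + 2^β)·Σ_{k=1}^{n} k^β ψ(k) for all n ∈ ℤ⁺. -/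
/-- If `s ⊆ Icc 1 n` and `n ≤ a * k` for all `k ∈ s`, then `n ^ β` times the sum of `ψ` over `s` is
at most `a ^ β` times the sum of `k ^ β * ψ k` over `Icc 1 n`. -/
theorem rpow_mul_sum_le_of_subset {β : ℝ} (hβ : 0 ≤ β) {ψ : ℕ → ℝ} (hψ : ∀ k, 0 ≤ ψ k) {a n : ℕ}
    {s : Finset ℕ} (hs : s ⊆ Finset.Icc 1 n) (ha : ∀ k ∈ s, n ≤ a * k) :
    (n : ℝ) ^ β * ∑ k ∈ s, ψ k ≤ (a : ℝ) ^ β * ∑ k ∈ Finset.Icc 1 n, (k : ℝ) ^ β * ψ k := by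
  calc (n : ℝ) ^ β * ∑ k ∈ s, ψ k
      ≤ (a : ℝ) ^ β * ∑ k ∈ s, (k : ℝ) ^ β * ψ k := by
        rw [Finset.mul_sum, Finset.mul_sum]
        refine Finset.sum_le_sum fun k hk => ?_
        rw [← mul_assoc, ← Real.mul_rpow (by positivity) (by positivity)]
        exact mul_le_mul_of_nonneg_right
          (Real.rpow_le_rpow (by positivity) (by exact_mod_cast ha k hk) hβ) (hψ k)
    _ ≤ _ := mul_le_mul_of_nonneg_left
        (Finset.sum_le_sum_of_subset_of_nonneg hs fun k _ _ => mul_nonneg (by positivity) (hψ k))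
        (by positivity)

/-- If a non-negative sequence `ψ` satisfies `Σ_{k=1}^n ψ(k) ≤ c Σ_{k=n}^{2n} ψ(k)` for all
`n ∈ ℤ⁺`, then `n^β Σ_{k=1}^n ψ(k) ≤ (4^β c + 2^β) Σ_{k=1}^n k^β ψ(k)` for all `n ∈ ℤ⁺`. -/
theorem stmt_1 (β : ℝ) (hβ : 0 ≤ β) (ψ : ℕ → ℝ) (hψ : ∀ k, 0 ≤ ψ k)
    (c : ℝ) (hc : 0 < c)
    (h : ∀ n : ℕ, 1 ≤ n →
      ∑ k ∈ Finset.Icc 1 n, ψ k ≤ c * ∑ k ∈ Finset.Icc n (2 * n), ψ k) :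
    ∀ n : ℕ, 1 ≤ n →
      (n : ℝ) ^ β * ∑ k ∈ Finset.Icc 1 n, ψ k ≤
        ((4 : ℝ) ^ β * c + (2 : ℝ) ^ β) * ∑ k ∈ Finset.Icc 1 n, (k : ℝ) ^ β * ψ k := by
  intro n hn
  have hupper : (n : ℝ) ^ β * ∑ k ∈ Finset.Ioc (n / 2) n, ψ k ≤
      (2 : ℝ) ^ β * ∑ k ∈ Finset.Icc 1 n, (k : ℝ) ^ β * ψ k := by
    refine mod_cast rpow_mul_sum_le_of_subset (a := 2) hβ hψ (fun k hk => ?_) fun k hk => ?_ <;>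
    · simp only [Finset.mem_Ioc, Finset.mem_Icc] at hk ⊢
      omega
  have hlower : (n : ℝ) ^ β * ∑ k ∈ Finset.Icc 1 (n / 2), ψ k ≤
      (4 : ℝ) ^ β * c * ∑ k ∈ Finset.Icc 1 n, (k : ℝ) ^ β * ψ k := by
    rcases Nat.eq_zero_or_pos (n / 2) with hm | hm
    · have hT : 0 ≤ ∑ k ∈ Finset.Icc 1 n, (k : ℝ) ^ β * ψ k :=
        Finset.sum_nonneg fun k _ => mul_nonneg (by positivity) (hψ k)
      simpa [hm] using mul_nonneg (by positivity : 0 ≤ (4 : ℝ) ^ β * c) hT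
    · have hmid : (n : ℝ) ^ β * ∑ k ∈ Finset.Icc (n / 2) (2 * (n / 2)), ψ k ≤
          (4 : ℝ) ^ β * ∑ k ∈ Finset.Icc 1 n, (k : ℝ) ^ β * ψ k := by
        refine mod_cast rpow_mul_sum_le_of_subset (a := 4) hβ hψ (fun k hk => ?_) fun k hk => ?_ <;>
        · simp only [Finset.mem_Icc] at hk ⊢
          omega
      calc (n : ℝ) ^ β * ∑ k ∈ Finset.Icc 1 (n / 2), ψ k
          ≤ (n : ℝ) ^ β * (c * ∑ k ∈ Finset.Icc (n / 2) (2 * (n / 2)), ψ k) :=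
            mul_le_mul_of_nonneg_left (h _ hm) (by positivity)
        _ = c * ((n : ℝ) ^ β * ∑ k ∈ Finset.Icc (n / 2) (2 * (n / 2)), ψ k) := by ring
        _ ≤ c * ((4 : ℝ) ^ β * ∑ k ∈ Finset.Icc 1 n, (k : ℝ) ^ β * ψ k) :=
            mul_le_mul_of_nonneg_left hmid hc.le
        _ = _ := by ring
  have hsplit : ∑ k ∈ Finset.Icc 1 n, ψ k =
      ∑ k ∈ Finset.Icc 1 (n / 2), ψ k + ∑ k ∈ Finset.Ioc (n / 2) n, ψ k := by
    rw [← Finset.sum_union]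
    · congr 1
      ext k
      simp only [Finset.mem_union, Finset.mem_Icc, Finset.mem_Ioc]
      omega
    · rw [Finset.disjoint_left]
      intro k hk
      simp only [Finset.mem_Icc, Finset.mem_Ioc] at hk ⊢
      omega
  rw [hsplit, mul_add, add_mul]
  exact add_le_add hlower hupper
end

section
/- Let β > 0 and let ψ : ℤ⁺ → ℝ be a non-negative sequence such that for some constant C > 1 one has n^β·Σ_{k=1}^{n} ψ(k) ≤ C·Σ_{k=1}^{n} k^β ψ(k) for all n ∈ ℤ⁺. Then for every positive integer m with m^β > C, one has Σ_{k=1}^{n} ψ(k) ≤ m^β·((C−1)/(m^β − C))·Σ_{k=n}^{mn} ψ(k) for all n ∈ ℤ⁺. -/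
/-- If a non-negative sequence `ψ` satisfies `n^β Σ_{k=1}^n ψ(k) ≤ C Σ_{k=1}^n k^β ψ(k)`
for all `n ∈ ℤ⁺` (with `C > 1`, `β > 0`), then for every positive integer `m` with `m^β > C`,
one has `Σ_{k=1}^n ψ(k) ≤ m^β ((C−1)/(m^β − C)) Σ_{k=n}^{mn} ψ(k)` for all `n ∈ ℤ⁺`. -/
theorem stmt_2 (β : ℝ) (hβ : 0 < β) (ψ : ℕ → ℝ) (hψ : ∀ k, 0 ≤ ψ k)
    (C : ℝ) (hC : 1 < C)
    (h : ∀ n : ℕ, 1 ≤ n →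
      (n : ℝ) ^ β * ∑ k ∈ Finset.Icc 1 n, ψ k ≤ C * ∑ k ∈ Finset.Icc 1 n, (k : ℝ) ^ β * ψ k) :
    ∀ m : ℕ, 0 < m → C < (m : ℝ) ^ β →
      ∀ n : ℕ, 1 ≤ n →
        ∑ k ∈ Finset.Icc 1 n, ψ k ≤
          (m : ℝ) ^ β * ((C - 1) / ((m : ℝ) ^ β - C)) * ∑ k ∈ Finset.Icc n (m * n), ψ k := by
  intro m hm hmC n hn
  have hn0 : (0 : ℝ) < n := by exact_mod_cast hn
  have hnm : n ≤ m * n := Nat.le_mul_of_pos_left n hm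
  have weighted_le (a b : ℕ) :
      ∑ k ∈ Finset.Icc a b, (k : ℝ) ^ β * ψ k ≤ (b : ℝ) ^ β * ∑ k ∈ Finset.Icc a b, ψ k := by
    rw [Finset.mul_sum]
    refine Finset.sum_le_sum fun k hk => mul_le_mul_of_nonneg_right ?_ (hψ k)
    exact Real.rpow_le_rpow k.cast_nonneg (Nat.cast_le.2 (Finset.mem_Icc.1 hk).2) hβ.le
  have split (f : ℕ → ℝ) : ∑ k ∈ Finset.Icc 1 (m * n), f k =
      ∑ k ∈ Finset.Icc 1 n, f k + ∑ k ∈ Finset.Icc (n + 1) (m * n), f k := by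
    rw [← Finset.sum_union (Finset.disjoint_left.2 fun k hk hk' => by
      simp only [Finset.mem_Icc] at hk hk'; omega)]
    congr 1
    ext k
    simp only [Finset.mem_union, Finset.mem_Icc]
    omega
  have tail_le : ∑ k ∈ Finset.Icc (n + 1) (m * n), ψ k ≤ ∑ k ∈ Finset.Icc n (m * n), ψ k :=
    Finset.sum_le_sum_of_subset_of_nonneg (Finset.Icc_subset_Icc_left n.le_succ)
      fun k _ _ => hψ k
  have key := h (m * n) (hn.trans hnm)
  have head_bound := weighted_le 1 n
  have tail_bound := weighted_le (n + 1) (m * n)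
  rw [split, split] at key
  rw [Nat.cast_mul, Real.mul_rpow m.cast_nonneg n.cast_nonneg] at key tail_bound
  have hnβ : 0 < (n : ℝ) ^ β := Real.rpow_pos_of_pos hn0 β
  set A := ∑ k ∈ Finset.Icc 1 n, ψ k
  set B := ∑ k ∈ Finset.Icc (n + 1) (m * n), ψ k
  have scaled : (n : ℝ) ^ β * (((m : ℝ) ^ β - C) * A) ≤
      (n : ℝ) ^ β * ((m : ℝ) ^ β * (C - 1) * B) := by
    have := mul_le_mul_of_nonneg_left (add_le_add head_bound tail_bound) (by linarith : 0 ≤ C)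
    linarith
  have main : ((m : ℝ) ^ β - C) * A ≤ (m : ℝ) ^ β * (C - 1) * B := le_of_mul_le_mul_left scaled hnβ
  have hpos : 0 < (m : ℝ) ^ β - C := sub_pos.2 hmC
  have hcoef : 0 ≤ (m : ℝ) ^ β * ((C - 1) / ((m : ℝ) ^ β - C)) :=
    mul_nonneg (by linarith) (div_nonneg (by linarith) hpos.le)
  refine le_trans ?_ (mul_le_mul_of_nonneg_left tail_le hcoef)
  rw [← mul_div_assoc, div_mul_eq_mul_div, le_div_iff₀ hpos]
  linarith
end

section
/- Let 0 < p < ∞, β ≥ 0, and let ψ : ℤ⁺ → ℝ be a non-negative sequence whose partial sums Ψ(n) = Σ_{τ=1}^{n} ψ(τ) are positive for all n and which satisfies Σ_{k=1}^{n} ψ(k) ≤ c·Σ_{k=n}^{2n} ψ(k) for all n ∈ ℤ⁺ and some constant c > 0. Then there is a constant C > 0 such that Σ_{n=1}^{∞} (A_ψ y)^p(n) v(n) ≤ C·Σ_{n=1}^{∞} y^p(n) v(n) holds for all non-negative sequences y ∈ Q_β if and only if there is a constant C' > 0 such that the weight sequence v satisfies (Σ_{k=1}^{n} k^β ψ(k))^p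 · Σ_{k=n}^{∞} Ψ(k)^{−p} v(k) ≤ C'·Σ_{k=1}^{n} k^{βp} v(k) for all n ∈ ℤ⁺. -/
open Finset

/-- Partial sums `Ψ(n) = Σ_{τ=1}^n ψ(τ)`. -/
noncomputable def PsiSum (ψ : ℕ → ℝ) (n : ℕ) : ℝ := ∑ τ ∈ Finset.Icc 1 n, ψ τ

/-- The generalized discrete Hardy averaging operator
`(A_ψ f)(n) = (1/Ψ(n)) Σ_{τ=1}^n f(τ) ψ(τ)`. -/
noncomputable def hardyAvg (ψ f : ℕ → ℝ) (n : ℕ) : ℝ :=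
  (1 / PsiSum ψ n) * ∑ τ ∈ Finset.Icc 1 n, f τ * ψ τ

/-- Summation by parts: domination of partial sums is preserved by non-increasing weights. -/
theorem sum_range_mul_le_of_antitone {h a b : ℕ → ℝ} (hh : Antitone h) (h0 : ∀ k, 0 ≤ h k)
    (hab : ∀ m, ∑ k ∈ range m, a k ≤ ∑ k ∈ range m, b k) (N : ℕ) :
    ∑ k ∈ range N, h k * a k ≤ ∑ k ∈ range N, h k * b k := by
  have key : ∀ N : ℕ, h N * (∑ k ∈ range N, b k - ∑ k ∈ range N, a k) ≤
      ∑ k ∈ range N, h k * b k - ∑ k ∈ range N, h k * a k := by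
    intro N
    induction N with
    | zero => simp
    | succ N ih =>
      have h1 := mul_le_mul_of_nonneg_right (hh (Nat.le_succ N))
        (sub_nonneg.2 (hab (N + 1)))
      simp only [sum_range_succ, Nat.succ_eq_add_one] at h1 ⊢
      linarith
  have := key N
  have := mul_nonneg (h0 N) (sub_nonneg.2 (hab N))
  linarith

/-- The increments of `x ↦ x ^ p` are non-increasing for `0 ≤ p ≤ 1`. -/
theorem rpow_add_sub_rpow_le {p x y t : ℝ} (hp : 0 ≤ p) (hp1 : p ≤ 1) (hx : 0 ≤ x)
    (hxy : x ≤ y) (ht : 0 ≤ t) : (y + t) ^ p - y ^ p ≤ (x + t) ^ p - x ^ p := by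
  rcases eq_or_lt_of_le (by linarith : 0 ≤ y + t - x) with hs | hs
  · have h1 : t = 0 := by linarith
    simp [h1]
  have hconc := Real.concaveOn_rpow hp hp1
  have ha : 0 ≤ t / (y + t - x) := by positivity
  have hb : 0 ≤ (y - x) / (y + t - x) := div_nonneg (by linarith) hs.le
  have hab : t / (y + t - x) + (y - x) / (y + t - x) = 1 := by
    field_simp
    ring
  have hx' : x ∈ Set.Ici (0 : ℝ) := hx
  have hy' : y + t ∈ Set.Ici (0 : ℝ) := by
    simp only [Set.mem_Ici]
    linarith
  have h1 := hconc.2 hx' hy' ha hb hab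
  have h2 := hconc.2 hx' hy' hb ha (by linarith)
  simp only [smul_eq_mul] at h1 h2
  have e1 : t / (y + t - x) * x + (y - x) / (y + t - x) * (y + t) = y := by
    field_simp
    ring
  have e2 : (y - x) / (y + t - x) * x + t / (y + t - x) * (y + t) = x + t := by
    field_simp
    ring
  rw [e1] at h1
  rw [e2] at h2
  have e3 : (t / (y + t - x) + (y - x) / (y + t - x)) * (x ^ p + (y + t) ^ p) =
      x ^ p + (y + t) ^ p := by rw [hab, one_mul]
  linarith

/-- The tangent-line bound for the increments of `x ↦ x ^ p`, `1 ≤ p`. -/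
theorem rpow_sub_rpow_le {p x y : ℝ} (hp : 1 ≤ p) (hy : 0 ≤ y) (hyx : y ≤ x) :
    x ^ p - y ^ p ≤ p * x ^ (p - 1) * (x - y) := by
  rcases eq_or_lt_of_le (hy.trans hyx) with hx | hx
  · have : y = x := le_antisymm hyx (hx ▸ hy)
    simp [this]
  have hs : -1 ≤ y / x - 1 := by
    have : 0 ≤ y / x := by positivity
    linarith
  have hB := one_add_mul_self_le_rpow_one_add hs hp
  rw [add_sub_cancel, Real.div_rpow hy hx.le, le_div_iff₀ (by positivity)] at hB
  have e : x ^ p = x ^ (p - 1) * x := by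
    rw [← Real.rpow_add_one hx.ne']
    ring_nf
  have e2 : (1 + p * (y / x - 1)) * x ^ p = x ^ p - p * x ^ (p - 1) * (x - y) := by
    rw [e]
    field_simp
    ring
  linarith

theorem rpow_sub_one_mul_le {p x y : ℝ} (hp : 1 ≤ p) (hy : 0 ≤ y) (hyx : y ≤ x) (hx : 0 < x) :
    x ^ (p - 1) * (x - y) ≤ x ^ p - y ^ p := by
  have h1 : y ^ p ≤ x ^ (p - 1) * y := by
    rcases eq_or_lt_of_le hy with h | h
    · rw [← h, Real.zero_rpow (by linarith)]
      simp
    · have e : y ^ p = y ^ (p - 1) * y := by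
        rw [← Real.rpow_add_one h.ne']
        ring_nf
      rw [e]
      exact mul_le_mul_of_nonneg_right (Real.rpow_le_rpow hy hyx (by linarith)) hy
  have e : x ^ p = x ^ (p - 1) * x := by
    rw [← Real.rpow_add_one hx.ne']
    ring_nf
  linarith

/-- A Young-type inequality with a small parameter. -/
theorem rpow_sub_one_mul_le_add {p a b ε : ℝ} (hp : 1 ≤ p) (ha : 0 ≤ a) (hb : 0 ≤ b)
    (hε : 0 < ε) : a ^ (p - 1) * b ≤ ε * a ^ p + ε ^ (1 - p) * b ^ p := by
  rcases le_total b (ε * a) with h | h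
  · have h2 : 0 ≤ ε ^ (1 - p) * b ^ p := by positivity
    rcases eq_or_lt_of_le ha with h0 | h0
    · have : b = 0 := le_antisymm (by simpa [← h0] using h) hb
      rw [this, mul_zero]
      positivity
    have e : a ^ p = a ^ (p - 1) * a := by
      rw [← Real.rpow_add_one h0.ne']
      ring_nf
    have := mul_le_mul_of_nonneg_left h (Real.rpow_nonneg ha (p - 1))
    rw [e]
    linarith
  · have h2 : 0 ≤ ε * a ^ p := by positivity
    rcases eq_or_lt_of_le hb with h0 | h0
    · rw [← h0, mul_zero]
      positivity
    have h3 : a ≤ b / ε := by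
      rw [le_div_iff₀ hε]
      linarith
    have h4 := Real.rpow_le_rpow ha h3 (by linarith : 0 ≤ p - 1)
    have e : b ^ p = b ^ (p - 1) * b := by
      rw [← Real.rpow_add_one h0.ne']
      ring_nf
    have e2 : ε ^ (1 - p) = (ε ^ (p - 1))⁻¹ := by
      rw [← Real.rpow_neg hε.le]
      ring_nf
    have h5 := mul_le_mul_of_nonneg_right h4 hb
    rw [Real.div_rpow hb hε.le] at h5
    have e3 : ε ^ (1 - p) * b ^ p = b ^ (p - 1) / ε ^ (p - 1) * b := by
      rw [e, e2]
      ring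
    linarith

section Weighted

variable {p : ℝ} {w u b : ℕ → ℝ}

/-- Testing the condition on non-increasing sequences: the linearised Hardy inequality. -/
theorem sum_mul_sum_rpow_diff_le (hp : 0 < p) (hw : ∀ k, 0 ≤ w k) (hu : ∀ k, 0 ≤ u k) {C : ℝ}
    (hcond : ∀ n N, (∑ i ∈ range (n + 1), w i) ^ p * ∑ k ∈ Ico n N, u k ≤
      C * ∑ k ∈ range (n + 1), b k)
    (hpt : ∀ n, (∑ i ∈ range (n + 1), w i) ^ p * u n ≤ b n)
    {h : ℕ → ℝ} (hh : Antitone h) (h0 : ∀ k, 0 ≤ h k) (N : ℕ) :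
    ∑ n ∈ range N, u n * ∑ k ∈ range (n + 1),
      h k * ((∑ i ∈ range (k + 1), w i) ^ p - (∑ i ∈ range k, w i) ^ p) ≤
      (C + 1) * ∑ n ∈ range N, h n * b n := by
  set W : ℕ → ℝ := fun n => ∑ i ∈ range n, w i with hW
  have hW0 : ∀ n, 0 ≤ W n := fun n => sum_nonneg fun i _ => hw i
  change ∀ n N, W (n + 1) ^ p * ∑ k ∈ Ico n N, u k ≤ C * ∑ k ∈ range (n + 1), b k at hcond
  change ∀ n, W (n + 1) ^ p * u n ≤ b n at hpt
  change ∑ n ∈ range N, u n * ∑ k ∈ range (n + 1), h k * (W (k + 1) ^ p - W k ^ p) ≤ _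
  set U : ℕ → ℝ := fun m => ∑ k ∈ Ico m N, u k with hU
  have hUs : ∀ m, U m ≤ u m + U (m + 1) := by
    intro m
    rcases lt_or_ge m N with hm | hm
    · exact (sum_eq_sum_Ico_succ_bot hm u).le
    · have : U m = 0 := by simp [hU, Ico_eq_empty_of_le hm]
      rw [this]
      exact add_nonneg (hu m) (sum_nonneg fun i _ => hu i)
  have hUanti : ∀ m, U (m + 1) ≤ U m := fun m =>
    sum_le_sum_of_subset_of_nonneg (Ico_subset_Ico_left (Nat.le_succ m)) fun i _ _ => hu i
  have hpart : ∀ m, ∑ k ∈ range m, (W (k + 1) ^ p - W k ^ p) * U k ≤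
      W m ^ p * U m + ∑ k ∈ range m, W (k + 1) ^ p * u k := by
    intro m
    induction m with
    | zero => simp [hW, Real.zero_rpow hp.ne']
    | succ m ih =>
      rw [sum_range_succ, sum_range_succ]
      have := mul_le_mul_of_nonneg_left (hUs m) (Real.rpow_nonneg (hW0 (m + 1)) p)
      linarith
  have hpart2 : ∀ m, ∑ k ∈ range m, (W (k + 1) ^ p - W k ^ p) * U k ≤
      ∑ k ∈ range m, (C + 1) * b k := by
    intro m
    have h1 : ∑ k ∈ range m, W (k + 1) ^ p * u k ≤ ∑ k ∈ range m, b k :=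
      sum_le_sum fun k _ => hpt k
    have h2 : W m ^ p * U m ≤ C * ∑ k ∈ range m, b k := by
      cases m with
      | zero => simp [hW, Real.zero_rpow hp.ne']
      | succ m =>
        exact (mul_le_mul_of_nonneg_left (hUanti m) (Real.rpow_nonneg (hW0 _) p)).trans
          (hcond m N)
    rw [← mul_sum]
    linarith [hpart m]
  have hswap : ∑ n ∈ range N, u n * ∑ k ∈ range (n + 1), h k * (W (k + 1) ^ p - W k ^ p) =
      ∑ k ∈ range N, h k * ((W (k + 1) ^ p - W k ^ p) * U k) := by
    simp_rw [hU, mul_sum]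
    refine sum_comm' ?_ |>.trans (sum_congr rfl fun k _ => sum_congr rfl fun n _ => by ring)
    intro n k
    simp only [mem_range, mem_Ico]
    omega
  rw [hswap]
  refine (sum_range_mul_le_of_antitone hh h0 hpart2 N).trans_eq ?_
  rw [mul_sum]
  exact sum_congr rfl fun k _ => by ring

theorem mul_sum_range_succ_le_sum {g : ℕ → ℝ} (hw : ∀ k, 0 ≤ w k) (hg : Antitone g) (n : ℕ) :
    g n * ∑ i ∈ range n, w i ≤ ∑ i ∈ range n, g i * w i := by
  rw [mul_sum]
  exact sum_le_sum fun i hi =>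
    mul_le_mul_of_nonneg_right (hg (mem_range.1 hi).le) (hw i)

theorem sum_mul_rpow_le_of_le_one (hp : 0 < p) (hp1 : p ≤ 1) {g : ℕ → ℝ} (hw : ∀ k, 0 ≤ w k)
    (hg : Antitone g) (hg0 : ∀ k, 0 ≤ g k) (n : ℕ) :
    (∑ i ∈ range n, g i * w i) ^ p ≤ ∑ k ∈ range n,
      g k ^ p * ((∑ i ∈ range (k + 1), w i) ^ p - (∑ i ∈ range k, w i) ^ p) := by
  induction n with
  | zero => simp [Real.zero_rpow hp.ne']
  | succ n ih =>
    rw [sum_range_succ (fun k => g k ^ p *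
      ((∑ i ∈ range (k + 1), w i) ^ p - (∑ i ∈ range k, w i) ^ p)) n]
    have hW : 0 ≤ ∑ i ∈ range n, w i := sum_nonneg fun i _ => hw i
    have h1 := rpow_add_sub_rpow_le hp.le hp1 (mul_nonneg (hg0 n) hW)
      (mul_sum_range_succ_le_sum hw hg n) (mul_nonneg (hg0 n) (hw n))
    rw [← mul_add, Real.mul_rpow (hg0 n) (add_nonneg hW (hw n)), Real.mul_rpow (hg0 n) hW,
      ← sum_range_succ, ← sum_range_succ] at h1
    linarith

theorem sum_div_sum_antitone {g : ℕ → ℝ} (hw : ∀ k, 0 ≤ w k) (hw0 : 0 < w 0)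
    (hg : Antitone g) :
    Antitone fun n => (∑ i ∈ range (n + 1), g i * w i) / ∑ i ∈ range (n + 1), w i := by
  have hW : ∀ n, 0 < ∑ i ∈ range (n + 1), w i := fun n =>
    sum_pos' (fun i _ => hw i) ⟨0, by simp, hw0⟩
  refine antitone_nat_of_succ_le fun n => ?_
  rw [div_le_div_iff₀ (hW _) (hW _), sum_range_succ _ (n + 1), sum_range_succ w (n + 1)]
  have h1 := mul_le_mul_of_nonneg_right (mul_sum_range_succ_le_sum hw hg (n + 1)) (hw (n + 1))
  linarith

theorem sum_mul_rpow_le_of_one_le (hp1 : 1 ≤ p) {g : ℕ → ℝ} (hw : ∀ k, 0 ≤ w k) (hw0 : 0 < w 0)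
    (hg0 : ∀ k, 0 ≤ g k) (n : ℕ) :
    (∑ i ∈ range n, g i * w i) ^ p ≤ p * ∑ k ∈ range n,
      ((∑ i ∈ range (k + 1), g i * w i) / ∑ i ∈ range (k + 1), w i) ^ (p - 1) * g k *
        ((∑ i ∈ range (k + 1), w i) ^ p - (∑ i ∈ range k, w i) ^ p) := by
  have hp : 0 < p := by linarith
  have hW : ∀ n, 0 < ∑ i ∈ range (n + 1), w i := fun n =>
    sum_pos' (fun i _ => hw i) ⟨0, by simp, hw0⟩
  have hF : ∀ n, 0 ≤ ∑ i ∈ range n, g i * w i := fun n =>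
    sum_nonneg fun i _ => mul_nonneg (hg0 i) (hw i)
  induction n with
  | zero => simp [Real.zero_rpow hp.ne']
  | succ n ih =>
    have hWn : 0 ≤ ∑ i ∈ range n, w i := sum_nonneg fun i _ => hw i
    have eF := sum_range_succ (fun i => g i * w i) n
    have eW := sum_range_succ w n
    rw [sum_range_succ (fun k =>
      ((∑ i ∈ range (k + 1), g i * w i) / ∑ i ∈ range (k + 1), w i) ^ (p - 1) * g k *
        ((∑ i ∈ range (k + 1), w i) ^ p - (∑ i ∈ range k, w i) ^ p)) n, mul_add]
    have h1 := rpow_sub_rpow_le hp1 (hF n)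
      (by rw [eF]; linarith [mul_nonneg (hg0 n) (hw n)] :
        _ ≤ ∑ i ∈ range (n + 1), g i * w i)
    have h2 := rpow_sub_one_mul_le hp1 hWn (by rw [eW]; linarith [hw n]) (hW n)
    have d1 : ∑ i ∈ range (n + 1), g i * w i - ∑ i ∈ range n, g i * w i = g n * w n := by
      rw [eF]; ring
    have d2 : ∑ i ∈ range (n + 1), w i - ∑ i ∈ range n, w i = w n := by
      rw [eW]; ring
    rw [d1] at h1
    rw [d2] at h2
    have h3 := mul_le_mul_of_nonneg_left h2 (mul_nonneg (Real.rpow_nonneg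
      (div_nonneg (hF (n + 1)) (hW n).le) (p - 1)) (hg0 n))
    have hWp : 0 < (∑ i ∈ range (n + 1), w i) ^ (p - 1) := Real.rpow_pos_of_pos (hW n) _
    have e : ((∑ i ∈ range (n + 1), g i * w i) / ∑ i ∈ range (n + 1), w i) ^ (p - 1) * g n *
        ((∑ i ∈ range (n + 1), w i) ^ (p - 1) * w n) =
        (∑ i ∈ range (n + 1), g i * w i) ^ (p - 1) * (g n * w n) := by
      rw [Real.div_rpow (hF _) (hW n).le]
      field_simp
    rw [e] at h3
    have h4 := mul_le_mul_of_nonneg_left h3 hp.le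
    linarith

/-- The weighted Hardy inequality for non-increasing sequences, in finite form. -/
theorem exists_hardy_antitone (hp : 0 < p) (hw : ∀ k, 0 ≤ w k) (hw0 : 0 < w 0)
    (hu : ∀ k, 0 ≤ u k) (hb : ∀ k, 0 ≤ b k) {C : ℝ} (hC : 0 < C)
    (hcond : ∀ n N, (∑ i ∈ range (n + 1), w i) ^ p * ∑ k ∈ Ico n N, u k ≤
      C * ∑ k ∈ range (n + 1), b k)
    (hpt : ∀ n, (∑ i ∈ range (n + 1), w i) ^ p * u n ≤ b n)
    {D : ℝ} (hD : 0 < D) (hpt' : ∀ n, b n ≤ D * ((∑ i ∈ range (n + 1), w i) ^ p * u n)) :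
    ∃ K : ℝ, 0 < K ∧ ∀ g : ℕ → ℝ, Antitone g → (∀ k, 0 ≤ g k) → ∀ N,
      ∑ n ∈ range N, u n * (∑ i ∈ range (n + 1), g i * w i) ^ p ≤
        K * ∑ n ∈ range N, g n ^ p * b n := by
  rcases le_total p 1 with hp1 | hp1
  · refine ⟨C + 1, by linarith, fun g hg hg0 N => ?_⟩
    refine le_trans (sum_le_sum fun n _ => mul_le_mul_of_nonneg_left
      (sum_mul_rpow_le_of_le_one hp hp1 hw hg hg0 (n + 1)) (hu n)) ?_
    exact sum_mul_sum_rpow_diff_le hp hw hu hcond hpt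
      (fun i j hij => Real.rpow_le_rpow (hg0 j) (hg hij) hp.le)
      (fun k => Real.rpow_nonneg (hg0 k) p) N
  · set M : ℝ := p * (C + 1) with hM
    have hMpos : 0 < M := by positivity
    set ε : ℝ := 1 / (2 * M * D) with hε
    have hεpos : 0 < ε := by positivity
    refine ⟨2 * M * ε ^ (1 - p), by positivity, fun g hg hg0 N => ?_⟩
    set F : ℕ → ℝ := fun n => ∑ i ∈ range (n + 1), g i * w i with hF
    set W : ℕ → ℝ := fun n => ∑ i ∈ range (n + 1), w i with hWdef
    have hW : ∀ n, 0 < W n := fun n => sum_pos' (fun i _ => hw i) ⟨0, by simp, hw0⟩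
    have hF0 : ∀ n, 0 ≤ F n := fun n => sum_nonneg fun i _ => mul_nonneg (hg0 i) (hw i)
    have hq0 : ∀ n, 0 ≤ F n / W n := fun n => div_nonneg (hF0 n) (hW n).le
    have hq : Antitone fun n => F n / W n := sum_div_sum_antitone hw hw0 hg
    have hh0 : ∀ n, 0 ≤ (F n / W n) ^ (p - 1) * g n := fun n =>
      mul_nonneg (Real.rpow_nonneg (hq0 n) _) (hg0 n)
    have hh : Antitone fun n => (F n / W n) ^ (p - 1) * g n := fun i j hij =>
      mul_le_mul (Real.rpow_le_rpow (hq0 j) (hq hij) (by linarith)) (hg hij) (hg0 j)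
        (Real.rpow_nonneg (hq0 i) _)
    have h1 : ∑ n ∈ range N, u n * F n ^ p ≤
        M * ∑ n ∈ range N, (F n / W n) ^ (p - 1) * g n * b n := by
      have h2 := mul_le_mul_of_nonneg_left
        (sum_mul_sum_rpow_diff_le hp hw hu hcond hpt hh hh0 N) hp.le
      rw [hM, mul_assoc]
      refine le_trans ?_ h2
      rw [mul_sum]
      refine sum_le_sum fun n _ => ?_
      have h3 := mul_le_mul_of_nonneg_left
        (sum_mul_rpow_le_of_one_le hp1 hw hw0 hg0 (n + 1)) (hu n)
      exact h3.trans_eq (by ring)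
    have h4 : ∑ n ∈ range N, (F n / W n) ^ (p - 1) * g n * b n ≤
        ε * D * ∑ n ∈ range N, u n * F n ^ p +
          ε ^ (1 - p) * ∑ n ∈ range N, g n ^ p * b n := by
      rw [mul_sum, mul_sum, ← sum_add_distrib]
      refine sum_le_sum fun n _ => ?_
      have h5 := mul_le_mul_of_nonneg_right
        (rpow_sub_one_mul_le_add hp1 (hq0 n) (hg0 n) hεpos) (hb n)
      have h6 : (F n / W n) ^ p * b n ≤ D * (u n * F n ^ p) := by
        refine (mul_le_mul_of_nonneg_left (hpt' n) (Real.rpow_nonneg (hq0 n) p)).trans_eq ?_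
        have hWp : 0 < W n ^ p := Real.rpow_pos_of_pos (hW n) _
        rw [Real.div_rpow (hF0 n) (hW n).le]
        change _ * (D * (W n ^ p * u n)) = _
        field_simp
      have h7 := mul_le_mul_of_nonneg_left h6 hεpos.le
      linarith
    have h8 := mul_le_mul_of_nonneg_left h4 hMpos.le
    have e : M * (ε * D) = 1 / 2 := by
      rw [hε]
      field_simp
    have e2 : M * (ε * D * ∑ n ∈ range N, u n * F n ^ p) =
        1 / 2 * ∑ n ∈ range N, u n * F n ^ p := by rw [← e]; ring
    change ∑ n ∈ range N, u n * F n ^ p ≤ _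
    linarith

end Weighted

theorem sum_Icc_one_eq_sum_range (f : ℕ → ℝ) (n : ℕ) :
    ∑ k ∈ Icc 1 n, f k = ∑ k ∈ range n, f (k + 1) := by
  rw [range_eq_Ico, sum_Ico_add' f 0 n 1]
  rfl

/-- Under the doubling condition, `n ^ β Ψ(n)` is controlled by `Σ_{k ≤ n} k ^ β ψ(k)`. -/
theorem rpow_mul_PsiSum_le {β c : ℝ} (hβ : 0 ≤ β) {ψ : ℕ → ℝ} (hψ : ∀ k, 0 ≤ ψ k)
    (hc : 0 < c) (hdbl : ∀ n : ℕ, 1 ≤ n →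
      ∑ k ∈ Icc 1 n, ψ k ≤ c * ∑ k ∈ Icc n (2 * n), ψ k) (n : ℕ) (hn : 1 ≤ n) :
    (n : ℝ) ^ β * PsiSum ψ n ≤ (c + 1) * 3 ^ β * ∑ k ∈ Icc 1 n, (k : ℝ) ^ β * ψ k := by
  obtain ⟨m, hm1, hmn, h2m, hn3⟩ : ∃ m, 1 ≤ m ∧ m ≤ n ∧ (2 * m ≤ n ∨ n = 1) ∧ n ≤ 3 * m := by
    rcases eq_or_lt_of_le hn with h | h
    · exact ⟨1, by omega, by omega, by omega, by omega⟩
    · exact ⟨n / 2, by omega, by omega, by omega, by omega⟩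
  have hS0 : 0 ≤ ∑ k ∈ Icc m n, ψ k := sum_nonneg fun k _ => hψ k
  have hΨ : PsiSum ψ n ≤ (c + 1) * ∑ k ∈ Icc m n, ψ k := by
    rcases h2m with h2m | h1
    · have h1 : PsiSum ψ n ≤ ∑ k ∈ Icc 1 m, ψ k + ∑ k ∈ Icc m n, ψ k := by
        rw [← sum_union_inter]
        have h2 : PsiSum ψ n ≤ ∑ k ∈ Icc 1 m ∪ Icc m n, ψ k :=
          sum_le_sum_of_subset_of_nonneg (fun k hk => by
            simp only [mem_union, mem_Icc] at hk ⊢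
            omega) fun k _ _ => hψ k
        have h3 : 0 ≤ ∑ k ∈ Icc 1 m ∩ Icc m n, ψ k := sum_nonneg fun k _ => hψ k
        linarith
      have h2 : ∑ k ∈ Icc m (2 * m), ψ k ≤ ∑ k ∈ Icc m n, ψ k :=
        sum_le_sum_of_subset_of_nonneg (Icc_subset_Icc_right h2m) fun k _ _ => hψ k
      have h3 := hdbl m hm1
      have h4 := mul_le_mul_of_nonneg_left h2 hc.le
      linarith
    · have hm : m = 1 := by omega
      subst hm
      have := mul_nonneg hc.le hS0
      change ∑ k ∈ Icc 1 n, ψ k ≤ _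
      linarith
  have hW : (m : ℝ) ^ β * ∑ k ∈ Icc m n, ψ k ≤ ∑ k ∈ Icc 1 n, (k : ℝ) ^ β * ψ k := by
    rw [mul_sum]
    refine le_trans (sum_le_sum (g := fun k : ℕ => (k : ℝ) ^ β * ψ k) fun k hk => ?_)
      (sum_le_sum_of_subset_of_nonneg (Icc_subset_Icc_left hm1) fun k _ _ =>
        mul_nonneg (Real.rpow_nonneg (Nat.cast_nonneg k) β) (hψ k))
    exact mul_le_mul_of_nonneg_right (Real.rpow_le_rpow (Nat.cast_nonneg m)
      (by exact_mod_cast (mem_Icc.1 hk).1) hβ) (hψ k)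
  have hnβ : (n : ℝ) ^ β ≤ 3 ^ β * (m : ℝ) ^ β := by
    rw [← Real.mul_rpow (by norm_num) (Nat.cast_nonneg m)]
    exact Real.rpow_le_rpow (Nat.cast_nonneg n) (by exact_mod_cast hn3) hβ
  calc (n : ℝ) ^ β * PsiSum ψ n
      ≤ (3 ^ β * (m : ℝ) ^ β) * ((c + 1) * ∑ k ∈ Icc m n, ψ k) :=
        mul_le_mul hnβ hΨ (sum_nonneg fun k _ => hψ k) (by positivity)
    _ = (c + 1) * 3 ^ β * ((m : ℝ) ^ β * ∑ k ∈ Icc m n, ψ k) := by ring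
    _ ≤ _ := mul_le_mul_of_nonneg_left hW (by positivity)

/-- Characterization of the boundedness of the generalized discrete Hardy averaging
operator on the class `Q_β` of quasi non-increasing sequences. -/
theorem stmt_3 (p β : ℝ) (hp : 0 < p) (hβ : 0 ≤ β)
    (ψ : ℕ → ℝ) (hψ : ∀ k, 0 ≤ ψ k)
    (hΨpos : ∀ n : ℕ, 1 ≤ n → 0 < PsiSum ψ n)
    (c : ℝ) (hc : 0 < c)
    (hdbl : ∀ n : ℕ, 1 ≤ n →
      ∑ k ∈ Finset.Icc 1 n, ψ k ≤ c * ∑ k ∈ Finset.Icc n (2 * n), ψ k)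
    (v : ℕ → ℝ) (hv : ∀ k, 0 ≤ v k) :
    (∃ C : ℝ, 0 < C ∧ ∀ y : ℕ → ℝ, (∀ k, 0 ≤ y k) →
        (∀ j k : ℕ, 1 ≤ j → j ≤ k → (k : ℝ) ^ (-β) * y k ≤ (j : ℝ) ^ (-β) * y j) →
        ∑' n : ℕ, ENNReal.ofReal ((hardyAvg ψ y (n + 1)) ^ p * v (n + 1)) ≤
          ENNReal.ofReal C * ∑' n : ℕ, ENNReal.ofReal ((y (n + 1)) ^ p * v (n + 1)))
    ↔
    (∃ C' : ℝ, 0 < C' ∧ ∀ n : ℕ, 1 ≤ n →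
        ENNReal.ofReal ((∑ k ∈ Finset.Icc 1 n, (k : ℝ) ^ β * ψ k) ^ p) *
          ∑' j : ℕ, ENNReal.ofReal ((PsiSum ψ (n + j)) ^ (-p) * v (n + j)) ≤
        ENNReal.ofReal (C' * ∑ k ∈ Finset.Icc 1 n, (k : ℝ) ^ (β * p) * v k)) := by
  constructor
  · rintro ⟨C, hC, H⟩
    refine ⟨C, hC, fun n hn => ?_⟩
    set W : ℝ := ∑ k ∈ Icc 1 n, (k : ℝ) ^ β * ψ k with hW
    have hW0 : 0 ≤ W := sum_nonneg fun k _ =>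
      mul_nonneg (Real.rpow_nonneg (Nat.cast_nonneg k) β) (hψ k)
    set y : ℕ → ℝ := fun k => if k ≤ n then (k : ℝ) ^ β else 0 with hy
    have hy0 : ∀ k, 0 ≤ y k := fun k => by
      simp only [hy]
      split_ifs <;> positivity
    have hyQ : ∀ j k : ℕ, 1 ≤ j → j ≤ k →
        (k : ℝ) ^ (-β) * y k ≤ (j : ℝ) ^ (-β) * y j := by
      intro j k hj hjk
      have e : ∀ i : ℕ, 1 ≤ i → (i : ℝ) ^ (-β) * (i : ℝ) ^ β = 1 := fun i hi => by
        have : (0 : ℝ) < i := by exact_mod_cast hi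
        rw [← Real.rpow_add this, neg_add_cancel, Real.rpow_zero]
      by_cases hk : k ≤ n
      · simp only [hy, hk, hjk.trans hk, if_true, e j hj, e k (hj.trans hjk), le_refl]
      · have : y k = 0 := by simp [hy, hk]
        rw [this, mul_zero]
        exact mul_nonneg (Real.rpow_nonneg (Nat.cast_nonneg j) _) (hy0 j)
    have hsum : ∀ m, n ≤ m → ∑ τ ∈ Icc 1 m, y τ * ψ τ = W := by
      intro m hm
      rw [hW, ← sum_subset (Icc_subset_Icc_right hm)]
      · refine sum_congr rfl fun k hk => ?_
        simp only [hy, (mem_Icc.1 hk).2, if_true]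
      · intro k hk hk'
        have : ¬ k ≤ n := fun h => hk' (mem_Icc.2 ⟨(mem_Icc.1 hk).1, h⟩)
        simp [hy, this]
    have hright : ∑' m : ℕ, ENNReal.ofReal ((y (m + 1)) ^ p * v (m + 1)) =
        ENNReal.ofReal (∑ k ∈ Icc 1 n, (k : ℝ) ^ (β * p) * v k) := by
      rw [tsum_eq_sum (s := range n), sum_Icc_one_eq_sum_range, ENNReal.ofReal_sum_of_nonneg]
      · refine sum_congr rfl fun k hk => ?_
        have : k + 1 ≤ n := mem_range.1 hk
        simp only [hy, this, if_true]
        rw [Real.rpow_mul (Nat.cast_nonneg _)]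
      · exact fun k _ => mul_nonneg (Real.rpow_nonneg (Nat.cast_nonneg _) _) (hv _)
      · intro k hk
        have : ¬ k + 1 ≤ n := fun h => hk (mem_range.2 h)
        simp [hy, this, Real.zero_rpow hp.ne']
    obtain ⟨m, rfl⟩ : ∃ m, n = m + 1 := ⟨n - 1, by omega⟩
    have hleft : ENNReal.ofReal (W ^ p) *
        ∑' j : ℕ, ENNReal.ofReal ((PsiSum ψ (m + 1 + j)) ^ (-p) * v (m + 1 + j)) ≤
        ∑' k : ℕ, ENNReal.ofReal ((hardyAvg ψ y (k + 1)) ^ p * v (k + 1)) := by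
      rw [← ENNReal.tsum_mul_left]
      refine le_trans (ENNReal.tsum_le_tsum fun j => ?_)
        (ENNReal.tsum_comp_le_tsum_of_injective (add_right_injective m) _)
      rw [← ENNReal.ofReal_mul (Real.rpow_nonneg hW0 p)]
      refine (congrArg ENNReal.ofReal ?_).le
      have hpos := hΨpos (m + 1 + j) (by omega)
      have e : m + j + 1 = m + 1 + j := by omega
      simp only [e]
      rw [hardyAvg, hsum _ (by omega), Real.mul_rpow (by positivity) hW0, one_div,
        Real.inv_rpow hpos.le, Real.rpow_neg hpos.le]
      ring
    rw [ENNReal.ofReal_mul hC.le, ← hright]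
    exact hleft.trans (H y hy0 hyQ)
  · rintro ⟨C, hC, H⟩
    set w : ℕ → ℝ := fun k => ((k + 1 : ℕ) : ℝ) ^ β * ψ (k + 1) with hwdef
    set u : ℕ → ℝ := fun k => PsiSum ψ (k + 1) ^ (-p) * v (k + 1) with hudef
    set b : ℕ → ℝ := fun k => ((k + 1 : ℕ) : ℝ) ^ (β * p) * v (k + 1) with hbdef
    have hw : ∀ k, 0 ≤ w k := fun k =>
      mul_nonneg (Real.rpow_nonneg (Nat.cast_nonneg _) β) (hψ _)
    have hw0 : 0 < w 0 := by
      have := hΨpos 1 le_rfl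
      simpa [PsiSum, hwdef] using this
    have hu : ∀ k, 0 ≤ u k := fun k =>
      mul_nonneg (Real.rpow_nonneg (hΨpos _ (by omega)).le _) (hv _)
    have hb : ∀ k, 0 ≤ b k := fun k =>
      mul_nonneg (Real.rpow_nonneg (Nat.cast_nonneg _) _) (hv _)
    have hW0 : ∀ n, 0 ≤ ∑ i ∈ range n, w i := fun n => sum_nonneg fun i _ => hw i
    have hcond : ∀ n N, (∑ i ∈ range (n + 1), w i) ^ p * ∑ k ∈ Ico n N, u k ≤
        C * ∑ k ∈ range (n + 1), b k := by
      intro n N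
      have hn := H (n + 1) (by omega)
      rw [sum_Icc_one_eq_sum_range, sum_Icc_one_eq_sum_range] at hn
      have h1 : ENNReal.ofReal (∑ k ∈ Ico n N, u k) ≤
          ∑' j : ℕ, ENNReal.ofReal (PsiSum ψ (n + 1 + j) ^ (-p) * v (n + 1 + j)) := by
        rw [ENNReal.ofReal_sum_of_nonneg fun k _ => hu k, sum_Ico_eq_sum_range]
        refine le_trans (le_of_eq (sum_congr rfl fun j _ => ?_))
          (ENNReal.sum_le_tsum (range (N - n)))
        simp only [hudef, show n + j + 1 = n + 1 + j by omega]
      have h2 := (mul_le_mul_right h1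
        (ENNReal.ofReal ((∑ i ∈ range (n + 1), w i) ^ p))).trans hn
      rw [← ENNReal.ofReal_mul (Real.rpow_nonneg (hW0 _) p)] at h2
      exact (ENNReal.ofReal_le_ofReal_iff
        (mul_nonneg hC.le (sum_nonneg fun k _ => hb k))).1 h2
    have hbu : ∀ n, b n = (((n + 1 : ℕ) : ℝ) ^ β * PsiSum ψ (n + 1)) ^ p * u n := by
      intro n
      have hpos := hΨpos (n + 1) (by omega)
      have : 0 < PsiSum ψ (n + 1) ^ p := Real.rpow_pos_of_pos hpos p
      simp only [hbdef, hudef]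
      rw [Real.mul_rpow (by positivity) hpos.le, Real.rpow_neg hpos.le,
        Real.rpow_mul (Nat.cast_nonneg _)]
      field_simp
    have hpt : ∀ n, (∑ i ∈ range (n + 1), w i) ^ p * u n ≤ b n := by
      intro n
      rw [hbu]
      refine mul_le_mul_of_nonneg_right (Real.rpow_le_rpow (hW0 _) ?_ hp.le) (hu n)
      rw [PsiSum, sum_Icc_one_eq_sum_range, mul_sum]
      refine sum_le_sum fun k hk => mul_le_mul_of_nonneg_right
        (Real.rpow_le_rpow (Nat.cast_nonneg _) ?_ hβ) (hψ _)
      have := mem_range.1 hk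
      exact_mod_cast (by omega : k + 1 ≤ n + 1)
    have hpt' : ∀ n, b n ≤
        ((c + 1) * 3 ^ β) ^ p * ((∑ i ∈ range (n + 1), w i) ^ p * u n) := by
      intro n
      have hpos := hΨpos (n + 1) (by omega)
      rw [hbu, ← mul_assoc (((c + 1) * 3 ^ β) ^ p), ← Real.mul_rpow (by positivity) (hW0 _)]
      refine mul_le_mul_of_nonneg_right (Real.rpow_le_rpow (by positivity) ?_ hp.le) (hu n)
      have := rpow_mul_PsiSum_le hβ hψ hc hdbl (n + 1) (by omega)
      rwa [sum_Icc_one_eq_sum_range] at this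
    obtain ⟨K, hK, hhardy⟩ := exists_hardy_antitone hp hw hw0 hu hb hC hcond hpt
      (by positivity) hpt'
    refine ⟨K, hK, fun y hy0 hyQ => ENNReal.tsum_le_of_sum_range_le fun N => ?_⟩
    set g : ℕ → ℝ := fun k => ((k + 1 : ℕ) : ℝ) ^ (-β) * y (k + 1) with hgdef
    have hg0 : ∀ k, 0 ≤ g k := fun k =>
      mul_nonneg (Real.rpow_nonneg (Nat.cast_nonneg _) _) (hy0 _)
    have hg : Antitone g := fun i j hij => hyQ (i + 1) (j + 1) (by omega) (by omega)
    have hyg : ∀ k, y (k + 1) = ((k + 1 : ℕ) : ℝ) ^ β * g k := fun k => by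
      have : (0 : ℝ) < ((k + 1 : ℕ) : ℝ) := by positivity
      simp only [hgdef]
      rw [← mul_assoc, ← Real.rpow_add this, add_neg_cancel, Real.rpow_zero, one_mul]
    have hgw : ∀ k, g k * w k = y (k + 1) * ψ (k + 1) := fun k => by
      rw [hyg]
      simp only [hwdef]
      ring
    have hgb : ∀ k, g k ^ p * b k = y (k + 1) ^ p * v (k + 1) := fun k => by
      rw [hyg, Real.mul_rpow (by positivity) (hg0 k)]
      simp only [hbdef]
      rw [Real.rpow_mul (Nat.cast_nonneg _)]
      ring
    have hA : ∀ n, hardyAvg ψ y (n + 1) ^ p * v (n + 1) =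
        u n * (∑ i ∈ range (n + 1), g i * w i) ^ p := fun n => by
      have hpos := hΨpos (n + 1) (by omega)
      simp only [hgw, hudef]
      rw [hardyAvg, sum_Icc_one_eq_sum_range, Real.mul_rpow (by positivity)
        (sum_nonneg fun k _ => mul_nonneg (hy0 _) (hψ _)), one_div, Real.inv_rpow hpos.le,
        Real.rpow_neg hpos.le]
      ring
    simp only [hA, ← hgb]
    rw [← ENNReal.ofReal_sum_of_nonneg fun n _ => mul_nonneg (hu n) (Real.rpow_nonneg
      (sum_nonneg fun i _ => mul_nonneg (hg0 i) (hw i)) p)]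
    refine (ENNReal.ofReal_le_ofReal (hhardy g hg hg0 N)).trans ?_
    rw [ENNReal.ofReal_mul hK.le, ENNReal.ofReal_sum_of_nonneg fun n _ =>
      mul_nonneg (Real.rpow_nonneg (hg0 n) p) (hb n)]
    gcongr
    exact ENNReal.sum_le_tsum (range N)
end

section
/- Let 0 < p < ∞ and β ≥ 0. Then there is a constant C > 0 such that Σ_{n=1}^{∞} ((1/n)·Σ_{k=1}^{n} y(k))^p v(n) ≤ C·Σ_{n=1}^{∞} y^p(n) v(n) holds for all non-negative sequences y ∈ Q_β if and only if there is a constant C' > 0 such that the weight sequence v satisfies Σ_{k=n}^{∞} (n/k)^p v(k) ≤ C'·Σ_{k=1}^{n} (k/n)^{βp} v(k) for all n ∈ ℤ⁺. -/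
open Finset in
/-- Summation by parts: if the partial sums of `w` up to `N * m` are at most `A` times those up to
`m`, then dilating a non-increasing non-negative sequence by `N` costs at most a factor `A`. -/
theorem sum_dilate_le {F w : ℕ → ℝ} {A : ℝ} {N : ℕ} (hN : 0 < N) (hF : Antitone F)
    (hF0 : ∀ n, 0 ≤ F n)
    (h : ∀ m, ∑ k ∈ range (N * m), w k ≤ A * ∑ k ∈ range m, w k) (M : ℕ) :
    ∑ n ∈ range (N * M), F (n / N) * w n ≤ A * ∑ m ∈ range M, F m * w m := by
  suffices H : F M * (A * ∑ k ∈ range M, w k - ∑ k ∈ range (N * M), w k) ≤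
      A * ∑ m ∈ range M, F m * w m - ∑ n ∈ range (N * M), F (n / N) * w n by
    have := mul_nonneg (hF0 M) (sub_nonneg.2 (h M))
    linarith
  induction M with
  | zero => simp
  | succ M ih =>
    have hblock : ∑ r ∈ range N, F ((N * M + r) / N) * w (N * M + r) =
        F M * ∑ r ∈ range N, w (N * M + r) := by
      rw [mul_sum]
      refine sum_congr rfl fun r hr => ?_
      rw [Nat.mul_add_div hN, Nat.div_eq_of_lt (mem_range.1 hr), add_zero]
    have h1 := mul_le_mul_of_nonneg_right (hF M.le_succ) (sub_nonneg.2 (h (M + 1)))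
    refine h1.trans ?_
    rw [Nat.mul_succ, sum_range_add _ (N * M) N, sum_range_add _ (N * M) N, hblock,
      sum_range_succ, sum_range_succ]
    linarith

open Finset in
/-- A tail condition on `w` forces its partial sums to grow, along dyadic dilations, at a rate
strictly smaller than the exponent `q`. -/
theorem exists_sum_two_pow_mul_le {w : ℕ → ℝ} {q C : ℝ} (hq : 0 < q) (hC : 1 ≤ C)
    (hw : ∀ k, 0 ≤ w k)
    (h : ∀ n : ℕ, 1 ≤ n → ∀ M : ℕ, ∑ k ∈ range M, (max (n : ℝ) ((k : ℝ) + 1)) ^ (-q) * w k ≤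
      C * ((n : ℝ) ^ (-q) * ∑ k ∈ range n, w k)) :
    ∃ θ : ℝ, 0 < θ ∧ θ < 1 ∧ ∀ i n : ℕ, 1 ≤ n →
      ∑ k ∈ range (2 ^ i * n), w k ≤ C * ((2 : ℝ) ^ q * θ) ^ i * ∑ k ∈ range n, w k := by
  set E : ℕ → ℕ → ℝ := fun M n => ∑ k ∈ range M, (max (n : ℝ) ((k : ℝ) + 1)) ^ (-q) * w k with hE
  have h2pos : (0 : ℝ) < 2 ^ (-q) := by positivity
  have h2lt : (2 : ℝ) ^ (-q) < 1 := Real.rpow_lt_one_of_one_lt_of_neg (by norm_num) (by linarith)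
  have hC0 : 0 < C := by linarith
  have hlow : ∀ M n : ℕ, 1 ≤ n → n ≤ M → (n : ℝ) ^ (-q) * ∑ k ∈ range n, w k ≤ E M n := by
    intro M n hn hnM
    rw [mul_sum]
    calc ∑ k ∈ range n, (n : ℝ) ^ (-q) * w k
        = ∑ k ∈ range n, (max (n : ℝ) ((k : ℝ) + 1)) ^ (-q) * w k := by
          refine sum_congr rfl fun k hk => ?_
          have hk' : (k : ℝ) + 1 ≤ n := by exact_mod_cast mem_range.1 hk
          rw [max_eq_left hk']
      _ ≤ E M n := by
          refine sum_le_sum_of_subset_of_nonneg (range_mono hnM) fun k _ _ => ?_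
          have := hw k
          positivity
  have hdiff : ∀ M n : ℕ, 1 ≤ n → n ≤ M →
      (1 - (2 : ℝ) ^ (-q)) * ((n : ℝ) ^ (-q) * ∑ k ∈ range n, w k) ≤ E M n - E M (2 * n) := by
    intro M n hn hnM
    have hn0 : (0 : ℝ) < n := by exact_mod_cast hn
    rw [hE]
    simp only
    rw [← sum_sub_distrib, mul_sum, mul_sum]
    calc ∑ k ∈ range n, (1 - (2 : ℝ) ^ (-q)) * ((n : ℝ) ^ (-q) * w k)
        = ∑ k ∈ range n, ((max (n : ℝ) ((k : ℝ) + 1)) ^ (-q) * w k -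
            (max ((2 * n : ℕ) : ℝ) ((k : ℝ) + 1)) ^ (-q) * w k) := by
          refine sum_congr rfl fun k hk => ?_
          have hk' : (k : ℝ) + 1 ≤ n := by exact_mod_cast mem_range.1 hk
          have hk2 : (k : ℝ) + 1 ≤ ((2 * n : ℕ) : ℝ) := by push_cast; linarith
          rw [max_eq_left hk', max_eq_left hk2]
          push_cast
          rw [Real.mul_rpow (by norm_num) hn0.le]
          ring
      _ ≤ _ := by
          refine sum_le_sum_of_subset_of_nonneg (range_mono hnM) fun k _ _ => ?_
          rw [← sub_mul]
          refine mul_nonneg (sub_nonneg.2 ?_) (hw k)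
          refine Real.rpow_le_rpow_of_nonpos (lt_max_of_lt_left hn0) ?_ (by linarith)
          refine max_le_max ?_ le_rfl
          push_cast
          linarith
  set θ : ℝ := 1 - (1 - (2 : ℝ) ^ (-q)) / C with hθ
  have hfrac : (1 - (2 : ℝ) ^ (-q)) / C < 1 := by
    rw [div_lt_one hC0]; linarith
  have hfrac0 : 0 < (1 - (2 : ℝ) ^ (-q)) / C := div_pos (by linarith) hC0
  have hθ0 : 0 < θ := by rw [hθ]; linarith
  refine ⟨θ, hθ0, by rw [hθ]; linarith, fun i n hn => ?_⟩
  have hstep : ∀ M n : ℕ, 1 ≤ n → n ≤ M → E M (2 * n) ≤ θ * E M n := by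
    intro M n hn hnM
    have h1 := hdiff M n hn hnM
    have h2 : E M n / C ≤ (n : ℝ) ^ (-q) * ∑ k ∈ range n, w k := by
      rw [div_le_iff₀' hC0]; exact h n hn M
    have h3 := mul_le_mul_of_nonneg_left h2 (sub_nonneg.2 h2lt.le)
    have h4 : θ * E M n = E M n - (1 - (2 : ℝ) ^ (-q)) * (E M n / C) := by rw [hθ]; ring
    rw [h4]
    linarith
  have hiter : ∀ M j : ℕ, 2 ^ j * n ≤ M → E M (2 ^ j * n) ≤ θ ^ j * E M n := by
    intro M j
    induction j with
    | zero => simp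
    | succ j ih =>
      intro hj
      have hpos : 1 ≤ 2 ^ j * n := Nat.mul_pos (by positivity) hn
      have hj' : 2 ^ j * n ≤ M := by
        rw [pow_succ'] at hj
        nlinarith
      have := hstep M _ hpos hj'
      rw [← mul_assoc, ← pow_succ'] at this
      calc _ ≤ _ := this
        _ ≤ θ * (θ ^ j * E M n) := mul_le_mul_of_nonneg_left (ih hj') hθ0.le
        _ = _ := by ring
  have hpos : 1 ≤ 2 ^ i * n := Nat.mul_pos (by positivity) hn
  have hn0 : (0 : ℝ) < n := by exact_mod_cast hn
  have key := ((hlow _ _ hpos le_rfl).trans (hiter _ i le_rfl)).trans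
    (mul_le_mul_of_nonneg_left (h n hn _) (by positivity))
  have hpw : ((2 ^ i * n : ℕ) : ℝ) ^ (-q) = (((2 : ℝ) ^ q) ^ i)⁻¹ * (n : ℝ) ^ (-q) := by
    push_cast
    rw [Real.mul_rpow (by positivity) hn0.le, Real.rpow_neg (by positivity), ← Real.rpow_natCast,
      ← Real.rpow_natCast, ← Real.rpow_mul (by norm_num), ← Real.rpow_mul (by norm_num),
      mul_comm q]
  rw [hpw] at key
  have hnq : (0 : ℝ) < (n : ℝ) ^ (-q) := by positivity
  have hA : (0 : ℝ) < ((2 : ℝ) ^ q) ^ i := by positivity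
  refine le_of_mul_le_mul_left ?_ hnq
  have key2 := mul_le_mul_of_nonneg_left key hA.le
  calc _ = ((2 : ℝ) ^ q) ^ i * ((((2 : ℝ) ^ q) ^ i)⁻¹ * (n : ℝ) ^ (-q) *
        ∑ k ∈ range (2 ^ i * n), w k) := by field_simp
    _ ≤ _ := key2
    _ = _ := by rw [mul_pow]; ring

open Finset in
theorem sum_rpow_sub_one_le {δ : ℝ} (hδ : 0 < δ) (hδ1 : δ ≤ 1) (n : ℕ) :
    ∑ k ∈ range n, ((k : ℝ) + 1) ^ (δ - 1) ≤ (n : ℝ) ^ δ / δ := by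
  induction n with
  | zero => simp [hδ.ne']
  | succ n ih =>
    rw [sum_range_succ]
    have hx : (0 : ℝ) < (n : ℝ) + 1 := by positivity
    have hinv : ((n : ℝ) + 1)⁻¹ ≤ 1 := inv_le_one_of_one_le₀ (by linarith [n.cast_nonneg (α := ℝ)])
    have hb := rpow_one_add_le_one_add_mul_self
      (s := -((n : ℝ) + 1)⁻¹) (by linarith) hδ.le hδ1
    have hn : (n : ℝ) = ((n : ℝ) + 1) * (1 + -((n : ℝ) + 1)⁻¹) := by field_simp; ring
    have h1 : (n : ℝ) ^ δ ≤ ((n : ℝ) + 1) ^ δ - δ * ((n : ℝ) + 1) ^ (δ - 1) := by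
      calc (n : ℝ) ^ δ = ((n : ℝ) + 1) ^ δ * (1 + -((n : ℝ) + 1)⁻¹) ^ δ := by
            rw [← Real.mul_rpow hx.le (by linarith), ← hn]
        _ ≤ ((n : ℝ) + 1) ^ δ * (1 + δ * -((n : ℝ) + 1)⁻¹) := by gcongr
        _ = _ := by rw [Real.rpow_sub_one hx.ne']; field_simp; ring
    rw [le_div_iff₀ hδ] at ih ⊢
    push_cast
    linarith

open Finset in
theorem rpow_add_one_div_le_sum {β : ℝ} (hβ : 0 ≤ β) (n : ℕ) :
    (n : ℝ) ^ (β + 1) / (β + 1) ≤ ∑ k ∈ Icc 1 n, (k : ℝ) ^ β := by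
  have hb1 : 0 < β + 1 := by linarith
  induction n with
  | zero => simp [hb1.ne']
  | succ n ih =>
    rw [sum_Icc_succ_top (by omega)]
    have hx : (0 : ℝ) < (n : ℝ) + 1 := by positivity
    have hinv : ((n : ℝ) + 1)⁻¹ ≤ 1 := inv_le_one_of_one_le₀ (by linarith [n.cast_nonneg (α := ℝ)])
    have hb := one_add_mul_self_le_rpow_one_add
      (s := -((n : ℝ) + 1)⁻¹) (p := β + 1) (by linarith) (by linarith)
    have hn : (n : ℝ) = ((n : ℝ) + 1) * (1 + -((n : ℝ) + 1)⁻¹) := by field_simp; ring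
    have h1 : ((n : ℝ) + 1) ^ (β + 1) - (β + 1) * ((n : ℝ) + 1) ^ β ≤ (n : ℝ) ^ (β + 1) := by
      calc _ = ((n : ℝ) + 1) ^ (β + 1) * (1 + (β + 1) * -((n : ℝ) + 1)⁻¹) := by
            rw [Real.rpow_add_one hx.ne']; field_simp; ring
        _ ≤ ((n : ℝ) + 1) ^ (β + 1) * (1 + -((n : ℝ) + 1)⁻¹) ^ (β + 1) := by gcongr
        _ = _ := by rw [← Real.mul_rpow hx.le (by linarith), ← hn]
    rw [div_le_iff₀ hb1] at ih ⊢
    push_cast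
    linarith

theorem exists_div_two_pow_le {n k : ℕ} (hk : k ≤ n) :
    ∃ i ≤ n, n / 2 ^ i ≤ k ∧ 2 ^ i * (k + 1) ≤ 2 * (n + 1) := by
  have hex : ∃ i, n < 2 ^ i * (k + 1) :=
    ⟨n, n.lt_two_pow_self.trans_le (Nat.le_mul_of_pos_right _ k.succ_pos)⟩
  refine ⟨Nat.find hex, Nat.find_min' hex
    (n.lt_two_pow_self.trans_le (Nat.le_mul_of_pos_right _ k.succ_pos)), ?_, ?_⟩
  · rw [← Nat.lt_succ_iff, Nat.div_lt_iff_lt_mul (by positivity), mul_comm]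
    exact Nat.find_spec hex
  · rcases hi : Nat.find hex with _ | j
    · simp; omega
    · have := Nat.find_min hex (m := j) (by omega)
      rw [pow_succ']
      nlinarith

open Finset in
/-- A weighted sum of a non-increasing sequence is controlled by its dyadic samples. -/
theorem sum_rpow_mul_le_of_dyadic {g : ℕ → ℝ} {p β δ S : ℝ} (hp : 0 < p) (hβ : 0 ≤ β)
    (hδ : 0 < δ) (hδ1 : δ ≤ 1) (hg : Antitone g) (hg0 : ∀ n, 0 ≤ g n) (n : ℕ)
    (hS : ∀ i ≤ n, ((2 : ℝ) ^ (-((1 + β - δ) * p))) ^ i * g (n / 2 ^ i) ^ p ≤ S) :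
    ∑ k ∈ range (n + 1), ((k : ℝ) + 1) ^ β * g k ≤
      2 ^ (1 + β - δ) / δ * ((n : ℝ) + 1) ^ (β + 1) * S ^ (1 / p) := by
  set s := 1 + β - δ with hs
  have hs0 : 0 ≤ s := by rw [hs]; linarith
  have hn : (0 : ℝ) < (n : ℝ) + 1 := by positivity
  have hS0 : 0 ≤ S := le_trans (mul_nonneg (by positivity) (Real.rpow_nonneg (hg0 _) _))
    (hS 0 (Nat.zero_le _))
  have hpt : ∀ k ∈ range (n + 1), ((k : ℝ) + 1) ^ β * g k ≤
      (2 * ((n : ℝ) + 1)) ^ s * S ^ (1 / p) * ((k : ℝ) + 1) ^ (δ - 1) := by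
    intro k hk
    have hk0 : (0 : ℝ) < (k : ℝ) + 1 := by positivity
    obtain ⟨i, hin, hik, hi2⟩ := exists_div_two_pow_le (Nat.lt_succ_iff.1 (mem_range.1 hk))
    have h2i : (0 : ℝ) < 2 ^ i := by positivity
    have hpow : ((2 : ℝ) ^ (-(s * p))) ^ i = ((((2 : ℝ) ^ i) ^ s)⁻¹) ^ p := by
      rw [← Real.rpow_neg h2i.le, ← Real.rpow_natCast, ← Real.rpow_natCast,
        ← Real.rpow_mul (by norm_num), ← Real.rpow_mul (by norm_num),
        ← Real.rpow_mul (by norm_num)]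
      ring_nf
    have h1 := hS i hin
    rw [hpow, ← Real.mul_rpow (by positivity) (hg0 _)] at h1
    have h2 := Real.rpow_le_rpow
      (Real.rpow_nonneg (mul_nonneg (by positivity) (hg0 _)) _) h1 (one_div_pos.2 hp).le
    rw [← Real.rpow_mul (mul_nonneg (by positivity) (hg0 _)), mul_one_div_cancel hp.ne',
      Real.rpow_one, inv_mul_le_iff₀ (by positivity)] at h2
    have h3 : (2 : ℝ) ^ i ≤ 2 * ((n : ℝ) + 1) / ((k : ℝ) + 1) := by
      rw [le_div_iff₀ hk0]; exact_mod_cast hi2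
    have h4 : g k ≤ (2 * ((n : ℝ) + 1) / ((k : ℝ) + 1)) ^ s * S ^ (1 / p) :=
      ((hg hik).trans h2).trans (by gcongr)
    calc ((k : ℝ) + 1) ^ β * g k
        ≤ ((k : ℝ) + 1) ^ β * ((2 * ((n : ℝ) + 1) / ((k : ℝ) + 1)) ^ s * S ^ (1 / p)) := by gcongr
      _ = (2 * ((n : ℝ) + 1)) ^ s * S ^ (1 / p) * (((k : ℝ) + 1) ^ β / ((k : ℝ) + 1) ^ s) := by
          rw [Real.div_rpow (by positivity) hk0.le]; ring
      _ = _ := by rw [← Real.rpow_sub hk0, hs]; ring_nf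
  refine (sum_le_sum hpt).trans ?_
  rw [← mul_sum]
  have h5 := sum_rpow_sub_one_le hδ hδ1 (n + 1)
  push_cast at h5
  refine (mul_le_mul_of_nonneg_left h5 (by positivity)).trans_eq ?_
  have h6 : ((n : ℝ) + 1) ^ (β + 1) = ((n : ℝ) + 1) ^ s * ((n : ℝ) + 1) ^ δ := by
    rw [← Real.rpow_add hn, hs]; ring_nf
  rw [h6, Real.mul_rpow (by norm_num) hn.le]
  ring

theorem exists_two_rpow_mul_lt_one {p θ : ℝ} (hθ : θ < 1) :
    ∃ δ : ℝ, 0 < δ ∧ δ ≤ 1 ∧ (2 : ℝ) ^ (δ * p) * θ < 1 := by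
  have hc : Continuous fun δ : ℝ => (2 : ℝ) ^ (δ * p) * θ := by
    have : Continuous fun δ : ℝ => (2 : ℝ) ^ (δ * p) :=
      Continuous.rpow continuous_const (by fun_prop) (fun _ => Or.inl (by norm_num))
    fun_prop
  have h0 : ∀ᶠ δ in nhds (0 : ℝ), (2 : ℝ) ^ (δ * p) * θ < 1 :=
    (hc.tendsto 0).eventually_lt_const (by simpa using hθ)
  obtain ⟨ε, hε, h⟩ := Metric.eventually_nhds_iff.1 h0
  refine ⟨min (ε / 2) 1, by positivity, min_le_right _ _, h ?_⟩
  rw [dist_zero_right, Real.norm_of_nonneg (by positivity)]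
  exact (min_le_left _ _).trans_lt (by linarith)

open Finset in
/-- Weighted inequality for the Hardy-type averages of non-increasing sequences. -/
theorem exists_sum_average_rpow_le {w : ℕ → ℝ} {p β C : ℝ} (hp : 0 < p) (hβ : 0 ≤ β) (hC : 1 ≤ C)
    (hw : ∀ k, 0 ≤ w k)
    (h : ∀ n : ℕ, 1 ≤ n → ∀ M : ℕ,
      ∑ k ∈ range M, (max (n : ℝ) ((k : ℝ) + 1)) ^ (-((1 + β) * p)) * w k ≤
      C * ((n : ℝ) ^ (-((1 + β) * p)) * ∑ k ∈ range n, w k)) :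
    ∃ K : ℝ, 0 < K ∧ ∀ g : ℕ → ℝ, Antitone g → (∀ n, 0 ≤ g n) → ∀ N : ℕ,
      ∑ n ∈ range N, ((∑ k ∈ range (n + 1), ((k : ℝ) + 1) ^ β * g k) /
        ((n : ℝ) + 1) ^ (β + 1)) ^ p * w n ≤ K * ∑ n ∈ range N, g n ^ p * w n := by
  obtain ⟨θ, hθ0, hθ1, hW⟩ := exists_sum_two_pow_mul_le (by positivity) hC hw h
  obtain ⟨δ, hδ, hδ1, hr⟩ := exists_two_rpow_mul_lt_one (p := p) hθ1
  set r := (2 : ℝ) ^ (δ * p) * θ with hrdef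
  set c := (2 : ℝ) ^ (-((1 + β - δ) * p)) with hc
  set D := (2 : ℝ) ^ (1 + β - δ) / δ with hD
  have hc0 : 0 < c := by positivity
  have hD0 : 0 < D := by positivity
  have hr0 : 0 < r := by positivity
  have hcr : c * ((2 : ℝ) ^ ((1 + β) * p) * θ) = r := by
    rw [hc, hrdef, ← mul_assoc, ← Real.rpow_add (by norm_num)]
    ring_nf
  have h1r : 0 < 1 - r := by linarith
  refine ⟨D ^ p * (C * (1 - r)⁻¹), by positivity, fun g hg hg0 N => ?_⟩
  have hF : Antitone fun n => g n ^ p := fun a b hab =>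
    Real.rpow_le_rpow (hg0 b) (hg hab) hp.le
  have hF0 : ∀ n, 0 ≤ g n ^ p := fun n => Real.rpow_nonneg (hg0 n) p
  have hpt : ∀ n ∈ range N, ((∑ k ∈ range (n + 1), ((k : ℝ) + 1) ^ β * g k) /
        ((n : ℝ) + 1) ^ (β + 1)) ^ p * w n ≤
        D ^ p * ∑ i ∈ range N, c ^ i * (g (n / 2 ^ i) ^ p * w n) := by
    intro n hn
    set S := ∑ i ∈ range N, c ^ i * g (n / 2 ^ i) ^ p with hSdef
    have hnn : ∀ i, 0 ≤ c ^ i * g (n / 2 ^ i) ^ p := fun i => mul_nonneg (by positivity) (hF0 _)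
    have hS0 : 0 ≤ S := sum_nonneg fun i _ => hnn i
    have hn0 : (0 : ℝ) < (n : ℝ) + 1 := by positivity
    have h1 := sum_rpow_mul_le_of_dyadic (S := S) hp hβ hδ hδ1 hg hg0 n fun i hi =>
      single_le_sum (f := fun i => c ^ i * g (n / 2 ^ i) ^ p) (fun i _ => hnn i)
        (mem_range.2 (hi.trans_lt (mem_range.1 hn)))
    have hsum0 : 0 ≤ ∑ k ∈ range (n + 1), ((k : ℝ) + 1) ^ β * g k :=
      sum_nonneg fun k _ => mul_nonneg (by positivity) (hg0 k)
    have h2 : (∑ k ∈ range (n + 1), ((k : ℝ) + 1) ^ β * g k) / ((n : ℝ) + 1) ^ (β + 1) ≤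
        D * S ^ (1 / p) := by
      rw [div_le_iff₀ (by positivity)]
      exact h1.trans_eq (by ring)
    have h3 := Real.rpow_le_rpow (by positivity) h2 hp.le
    rw [Real.mul_rpow hD0.le (by positivity), ← Real.rpow_mul hS0, one_div_mul_cancel hp.ne',
      Real.rpow_one] at h3
    refine (mul_le_mul_of_nonneg_right h3 (hw n)).trans_eq ?_
    rw [hSdef, mul_assoc, sum_mul]
    simp only [mul_assoc]
  have hT0 : 0 ≤ ∑ n ∈ range N, g n ^ p * w n := sum_nonneg fun n _ => mul_nonneg (hF0 n) (hw n)
  have hdil : ∀ i, ∑ n ∈ range N, g (n / 2 ^ i) ^ p * w n ≤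
      C * ((2 : ℝ) ^ ((1 + β) * p) * θ) ^ i * ∑ n ∈ range N, g n ^ p * w n := by
    intro i
    refine le_trans ?_ (sum_dilate_le (N := 2 ^ i) (by positivity) hF hF0 (fun m => ?_) N)
    · exact sum_le_sum_of_subset_of_nonneg
        (range_mono (Nat.le_mul_of_pos_left _ (by positivity)))
        fun n _ _ => mul_nonneg (hF0 _) (hw n)
    · rcases Nat.eq_zero_or_pos m with rfl | hm
      · simp
      · exact hW i m hm
  have hgeom : ∑ i ∈ range N, r ^ i ≤ (1 - r)⁻¹ := by
    rw [← tsum_geometric_of_lt_one hr0.le hr]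
    exact (summable_geometric_of_lt_one hr0.le hr).sum_le_tsum _ fun i _ => by positivity
  calc _ ≤ ∑ n ∈ range N, D ^ p * ∑ i ∈ range N, c ^ i * (g (n / 2 ^ i) ^ p * w n) :=
        sum_le_sum hpt
    _ = D ^ p * ∑ i ∈ range N, c ^ i * ∑ n ∈ range N, g (n / 2 ^ i) ^ p * w n := by
        rw [← mul_sum, sum_comm]
        simp only [mul_sum]
    _ ≤ D ^ p * ∑ i ∈ range N, c ^ i * (C * ((2 : ℝ) ^ ((1 + β) * p) * θ) ^ i *
          ∑ n ∈ range N, g n ^ p * w n) := by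
        gcongr with i _
        exact hdil i
    _ = D ^ p * (C * ∑ i ∈ range N, r ^ i) * ∑ n ∈ range N, g n ^ p * w n := by
        generalize ∑ n ∈ range N, g n ^ p * w n = T
        rw [mul_assoc]
        congr 1
        rw [mul_sum, sum_mul]
        refine sum_congr rfl fun i _ => ?_
        rw [← hcr, mul_pow]
        ring
    _ ≤ _ := by gcongr

open Finset in
theorem tail_bound_of_hardy_bound {p β C : ℝ} (hp : 0 < p) (hβ : 0 ≤ β) (hC : 0 < C)
    {v : ℕ → ℝ} (hv : ∀ k, 0 ≤ v k)
    (h : ∀ y : ℕ → ℝ, (∀ k, 0 ≤ y k) →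
        (∀ j k : ℕ, 1 ≤ j → j ≤ k → (k : ℝ) ^ (-β) * y k ≤ (j : ℝ) ^ (-β) * y j) →
        ∑' n : ℕ, ENNReal.ofReal
            (((1 / ((n : ℝ) + 1)) * ∑ k ∈ Icc 1 (n + 1), y k) ^ p * v (n + 1)) ≤
          ENNReal.ofReal C * ∑' n : ℕ, ENNReal.ofReal ((y (n + 1)) ^ p * v (n + 1)))
    {n : ℕ} (hn : 1 ≤ n) :
    ∑' j : ℕ, ENNReal.ofReal (((n : ℝ) / ((n : ℝ) + j)) ^ p * v (n + j)) ≤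
      ENNReal.ofReal (C * (β + 1) ^ p * ∑ k ∈ Icc 1 n, ((k : ℝ) / n) ^ (β * p) * v k) := by
  have hn0 : (0 : ℝ) < n := by exact_mod_cast hn
  set y : ℕ → ℝ := fun k => if k ≤ n then (k : ℝ) ^ β else 0 with hy
  have hy0 : ∀ k, 0 ≤ y k := fun k => by
    simp only [hy]
    split_ifs <;> positivity
  have hcancel : ∀ k : ℕ, 1 ≤ k → (k : ℝ) ^ (-β) * (k : ℝ) ^ β = 1 := fun k hk => by
    have : (0 : ℝ) < k := by exact_mod_cast hk
    rw [← Real.rpow_add this, neg_add_cancel, Real.rpow_zero]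
  have key := h y hy0 fun j k hj hjk => by
    by_cases hk : k ≤ n
    · simp only [hy, hk, hjk.trans hk, if_true]
      rw [hcancel k (hj.trans hjk), hcancel j hj]
    · have := hy0 j
      have h0 : y k = 0 := by simp [hy, hk]
      rw [h0, mul_zero]
      positivity
  have hR : ∑' m : ℕ, ENNReal.ofReal (y (m + 1) ^ p * v (m + 1)) =
      ENNReal.ofReal (∑ k ∈ Icc 1 n, (k : ℝ) ^ (β * p) * v k) := by
    rw [tsum_eq_sum (s := range n), ← ENNReal.ofReal_sum_of_nonneg]
    · congr 1
      rw [range_eq_Ico, sum_Ico_add' (fun k => y k ^ p * v k) 0 n 1]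
      refine sum_congr (by ext; simp) fun k hk => ?_
      simp only [hy, (mem_Icc.1 hk).2, if_true]
      rw [Real.rpow_mul (by positivity)]
    · intro m _
      exact mul_nonneg (Real.rpow_nonneg (hy0 _) _) (hv _)
    · intro m hm
      have : ¬ m + 1 ≤ n := by simpa using hm
      simp [hy, this, Real.zero_rpow hp.ne']
  set F : ℕ → ENNReal := fun m => ENNReal.ofReal
    (((1 / ((m : ℝ) + 1)) * ∑ k ∈ Icc 1 (m + 1), y k) ^ p * v (m + 1)) with hF
  set B : ℝ := (β + 1) / (n : ℝ) ^ β with hB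
  have hB0 : 0 < B := by positivity
  have hterm : ∀ j : ℕ, ENNReal.ofReal (((n : ℝ) / ((n : ℝ) + j)) ^ p * v (n + j)) ≤
      ENNReal.ofReal (B ^ p) * F (n - 1 + j) := by
    intro j
    have hidx : n - 1 + j + 1 = n + j := by omega
    have hcast : ((n - 1 + j : ℕ) : ℝ) + 1 = (n : ℝ) + j := by exact_mod_cast hidx
    have hnj : (0 : ℝ) < (n : ℝ) + j := by positivity
    have hs0 : 0 ≤ ∑ k ∈ Icc 1 (n + j), y k := sum_nonneg fun k _ => hy0 k
    simp only [hF, hidx, hcast]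
    rw [← ENNReal.ofReal_mul (by positivity), ← mul_assoc,
      ← Real.mul_rpow hB0.le (by positivity)]
    refine ENNReal.ofReal_le_ofReal (mul_le_mul_of_nonneg_right ?_ (hv _))
    refine Real.rpow_le_rpow (by positivity) ?_ hp.le
    have hs : (n : ℝ) ^ (β + 1) / (β + 1) ≤ ∑ k ∈ Icc 1 (n + j), y k := by
      refine (rpow_add_one_div_le_sum hβ n).trans ?_
      calc ∑ k ∈ Icc 1 n, (k : ℝ) ^ β = ∑ k ∈ Icc 1 n, y k :=
            sum_congr rfl fun k hk => by simp only [hy, (mem_Icc.1 hk).2, if_true]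
        _ ≤ _ := sum_le_sum_of_subset_of_nonneg (Icc_subset_Icc_right (by omega))
            fun k _ _ => hy0 k
    calc (n : ℝ) / ((n : ℝ) + j)
        = B * (1 / ((n : ℝ) + j) * ((n : ℝ) ^ (β + 1) / (β + 1))) := by
          rw [hB, Real.rpow_add_one hn0.ne']
          field_simp
      _ ≤ _ := by gcongr
  calc _ ≤ ∑' j : ℕ, ENNReal.ofReal (B ^ p) * F (n - 1 + j) := ENNReal.tsum_le_tsum hterm
    _ = ENNReal.ofReal (B ^ p) * ∑' j : ℕ, F (n - 1 + j) := ENNReal.tsum_mul_left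
    _ ≤ ENNReal.ofReal (B ^ p) * ∑' m : ℕ, F m := by
        refine mul_le_mul' le_rfl ?_
        exact ENNReal.tsum_comp_le_tsum_of_injective (add_right_injective (n - 1)) F
    _ ≤ ENNReal.ofReal (B ^ p) * (ENNReal.ofReal C *
          ENNReal.ofReal (∑ k ∈ Icc 1 n, (k : ℝ) ^ (β * p) * v k)) := by
        rw [← hR]
        gcongr
    _ = _ := by
        rw [← ENNReal.ofReal_mul hC.le, ← ENNReal.ofReal_mul (by positivity)]
        congr 1
        have : ∀ k : ℕ, ((k : ℝ) / n) ^ (β * p) * v k =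
            (((n : ℝ) ^ β) ^ p)⁻¹ * ((k : ℝ) ^ (β * p) * v k) := fun k => by
          rw [Real.div_rpow (by positivity) hn0.le, ← Real.rpow_mul hn0.le]
          ring
        simp only [this]
        rw [← mul_sum, hB, Real.div_rpow (by positivity) (by positivity)]
        ring

open Finset in
theorem sum_max_rpow_le_of_tail_bound {p β C : ℝ} (hC : 0 < C)
    {v : ℕ → ℝ} (hv : ∀ k, 0 ≤ v k) {n : ℕ} (hn : 1 ≤ n)
    (h : ∑' j : ℕ, ENNReal.ofReal (((n : ℝ) / ((n : ℝ) + j)) ^ p * v (n + j)) ≤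
      ENNReal.ofReal (C * ∑ k ∈ Icc 1 n, ((k : ℝ) / n) ^ (β * p) * v k)) (M : ℕ) :
    ∑ k ∈ range M, (max (n : ℝ) ((k : ℝ) + 1)) ^ (-((1 + β) * p)) *
        (((k : ℝ) + 1) ^ (β * p) * v (k + 1)) ≤
      (1 + C) * ((n : ℝ) ^ (-((1 + β) * p)) *
        ∑ k ∈ range n, ((k : ℝ) + 1) ^ (β * p) * v (k + 1)) := by
  have hn0 : (0 : ℝ) < n := by exact_mod_cast hn
  have hW : ∑ k ∈ Icc 1 n, ((k : ℝ) / n) ^ (β * p) * v k =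
      (n : ℝ) ^ (-(β * p)) * ∑ k ∈ range n, ((k : ℝ) + 1) ^ (β * p) * v (k + 1) := by
    have h1 : ∑ k ∈ range n, ((k : ℝ) + 1) ^ (β * p) * v (k + 1) =
        ∑ k ∈ Icc 1 n, (k : ℝ) ^ (β * p) * v k := by
      have := sum_Ico_add' (fun k : ℕ => (k : ℝ) ^ (β * p) * v k) 0 n 1
      push_cast at this
      rw [range_eq_Ico, this]
      exact sum_congr (by ext; simp) fun k _ => rfl
    rw [h1, mul_sum]
    refine sum_congr rfl fun k _ => ?_
    rw [Real.div_rpow (by positivity) hn0.le, Real.rpow_neg hn0.le]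
    ring
  set W := ∑ k ∈ range n, ((k : ℝ) + 1) ^ (β * p) * v (k + 1) with hWdef
  have hW0 : 0 ≤ W := sum_nonneg fun k _ => mul_nonneg (by positivity) (hv _)
  have hterm : ∀ j : ℕ, 0 ≤ ((n : ℝ) / ((n : ℝ) + j)) ^ p * v (n + j) := fun j =>
    mul_nonneg (by positivity) (hv _)
  have htail : ∑ j ∈ range (M + 1), ((n : ℝ) / ((n : ℝ) + j)) ^ p * v (n + j) ≤
      C * ((n : ℝ) ^ (-(β * p)) * W) := by
    rw [hW] at h
    refine (ENNReal.ofReal_le_ofReal_iff (by positivity)).1 ?_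
    rw [ENNReal.ofReal_sum_of_nonneg fun j _ => hterm j]
    exact (ENNReal.sum_le_tsum _).trans h
  rw [sum_range_succ'] at htail
  have htail' := (le_add_of_nonneg_right (hterm 0)).trans htail
  have hnn : ∀ k : ℕ, 0 ≤ (max (n : ℝ) ((k : ℝ) + 1)) ^ (-((1 + β) * p)) *
        (((k : ℝ) + 1) ^ (β * p) * v (k + 1)) := fun k =>
    mul_nonneg (by positivity) (mul_nonneg (by positivity) (hv _))
  refine (sum_le_sum_of_subset_of_nonneg (range_mono (Nat.le_add_left M n))
    fun k _ _ => hnn k).trans ?_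
  rw [sum_range_add, add_mul (1 : ℝ) C, one_mul]
  refine add_le_add (le_of_eq ?_) ?_
  · rw [hWdef, mul_sum]
    refine sum_congr rfl fun k hk => ?_
    have hk' : (k : ℝ) + 1 ≤ n := by exact_mod_cast mem_range.1 hk
    rw [max_eq_left hk']
  · have hsplit : (n : ℝ) ^ (-((1 + β) * p)) = (n : ℝ) ^ (-p) * (n : ℝ) ^ (-(β * p)) := by
      rw [← Real.rpow_add hn0]
      ring_nf
    have hnp : (0 : ℝ) < (n : ℝ) ^ (-p) := by positivity
    refine le_trans (le_of_eq ?_) ((mul_le_mul_of_nonneg_left htail' hnp.le).trans_eq ?_)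
    · rw [mul_sum]
      refine sum_congr rfl fun j _ => ?_
      have hx : (0 : ℝ) < (n : ℝ) + ((j + 1 : ℕ) : ℝ) := by positivity
      have hcast : ((n + j : ℕ) : ℝ) + 1 = (n : ℝ) + ((j + 1 : ℕ) : ℝ) := by push_cast; ring
      have hle : (n : ℝ) ≤ (n : ℝ) + ((j + 1 : ℕ) : ℝ) := by linarith [(j + 1).cast_nonneg (α := ℝ)]
      rw [hcast, max_eq_right hle, ← mul_assoc, ← Real.rpow_add hx, Real.div_rpow hn0.le hx.le,
        Real.rpow_neg hn0.le, add_assoc n j 1]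
      have : -((1 + β) * p) + β * p = -p := by ring
      rw [this, Real.rpow_neg hx.le]
      field_simp
    · rw [hsplit]
      ring


/-- Characterization of the boundedness of the discrete Hardy averaging operator
`(A y)(n) = (1/n) Σ_{k=1}^n y(k)` on the class `Q_β` of quasi non-increasing sequences. -/
theorem stmt_5 (p β : ℝ) (hp : 0 < p) (hβ : 0 ≤ β)
    (v : ℕ → ℝ) (hv : ∀ k, 0 ≤ v k) :
    (∃ C : ℝ, 0 < C ∧ ∀ y : ℕ → ℝ, (∀ k, 0 ≤ y k) →
        (∀ j k : ℕ, 1 ≤ j → j ≤ k → (k : ℝ) ^ (-β) * y k ≤ (j : ℝ) ^ (-β) * y j) →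
        ∑' n : ℕ, ENNReal.ofReal
            (((1 / ((n : ℝ) + 1)) * ∑ k ∈ Finset.Icc 1 (n + 1), y k) ^ p * v (n + 1)) ≤
          ENNReal.ofReal C * ∑' n : ℕ, ENNReal.ofReal ((y (n + 1)) ^ p * v (n + 1)))
    ↔
    (∃ C' : ℝ, 0 < C' ∧ ∀ n : ℕ, 1 ≤ n →
        ∑' j : ℕ, ENNReal.ofReal (((n : ℝ) / ((n : ℝ) + j)) ^ p * v (n + j)) ≤
          ENNReal.ofReal (C' * ∑ k ∈ Finset.Icc 1 n, ((k : ℝ) / n) ^ (β * p) * v k)) := by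
  constructor
  · rintro ⟨C, hC, h⟩
    exact ⟨C * (β + 1) ^ p, by positivity, fun n hn => tail_bound_of_hardy_bound hp hβ hC hv h hn⟩
  · rintro ⟨C, hC, h⟩
    obtain ⟨K, hK, hmain⟩ := exists_sum_average_rpow_le hp hβ (by linarith : 1 ≤ 1 + C)
      (w := fun k => ((k : ℝ) + 1) ^ (β * p) * v (k + 1))
      (fun k => mul_nonneg (by positivity) (hv _))
      fun n hn M => sum_max_rpow_le_of_tail_bound hC hv hn (h n hn) M
    refine ⟨K, hK, fun y hy0 hy => ?_⟩
    have hg := hmain (fun k => ((k : ℝ) + 1) ^ (-β) * y (k + 1))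
      (fun a b hab => by simpa using hy (a + 1) (b + 1) (by omega) (by omega))
      (fun k => mul_nonneg (by positivity) (hy0 _))
    have hcancel : ∀ k : ℕ, ((k : ℝ) + 1) ^ β * (((k : ℝ) + 1) ^ (-β) * y (k + 1)) = y (k + 1) :=
      fun k => by
        have hk : (0 : ℝ) < (k : ℝ) + 1 := by positivity
        rw [← mul_assoc, ← Real.rpow_add hk, add_neg_cancel, Real.rpow_zero, one_mul]
    have hright : ∀ k : ℕ, (((k : ℝ) + 1) ^ (-β) * y (k + 1)) ^ p *
        (((k : ℝ) + 1) ^ (β * p) * v (k + 1)) = y (k + 1) ^ p * v (k + 1) := fun k => by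
      have hk : (0 : ℝ) < (k : ℝ) + 1 := by positivity
      rw [Real.rpow_mul hk.le, ← mul_assoc,
        ← Real.mul_rpow (mul_nonneg (by positivity) (hy0 _)) (by positivity), mul_comm _ (_ ^ β),
        hcancel]
    have hleft : ∀ n : ℕ, ((∑ k ∈ Finset.range (n + 1), y (k + 1)) /
        ((n : ℝ) + 1) ^ (β + 1)) ^ p * (((n : ℝ) + 1) ^ (β * p) * v (n + 1)) =
        ((1 / ((n : ℝ) + 1)) * ∑ k ∈ Finset.Icc 1 (n + 1), y k) ^ p * v (n + 1) := fun n => by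
      have hn : (0 : ℝ) < (n : ℝ) + 1 := by positivity
      have hsum : ∑ k ∈ Finset.range (n + 1), y (k + 1) = ∑ k ∈ Finset.Icc 1 (n + 1), y k := by
        rw [Finset.range_eq_Ico, Finset.sum_Ico_add' y 0 (n + 1) 1]
        exact Finset.sum_congr (by ext; simp) fun k _ => rfl
      have hsum0 : 0 ≤ ∑ k ∈ Finset.Icc 1 (n + 1), y k := Finset.sum_nonneg fun k _ => hy0 k
      rw [hsum, Real.rpow_mul hn.le, ← mul_assoc,
        ← Real.mul_rpow (by positivity) (by positivity), Real.rpow_add_one hn.ne']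
      congr 2
      field_simp
    simp only [hcancel, hright, hleft] at hg
    have hR0 : ∀ n : ℕ, 0 ≤ y (n + 1) ^ p * v (n + 1) := fun n =>
      mul_nonneg (Real.rpow_nonneg (hy0 _) _) (hv _)
    refine ENNReal.tsum_le_of_sum_range_le fun N => ?_
    rw [← ENNReal.ofReal_sum_of_nonneg fun n _ => ?_]
    · refine (ENNReal.ofReal_le_ofReal (hg N)).trans ?_
      rw [ENNReal.ofReal_mul hK.le, ENNReal.ofReal_sum_of_nonneg fun n _ => hR0 n]
      gcongr
      exact ENNReal.sum_le_tsum _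
    · have : 0 ≤ ∑ k ∈ Finset.Icc 1 (n + 1), y k := Finset.sum_nonneg fun k _ => hy0 k
      exact mul_nonneg (by positivity) (hv _)
end

section
/- Let p > 0 and let w : ℤ⁺ → ℝ be a non-negative sequence satisfying Σ_{k=n}^{∞} (n/k)^p w(k) ≤ c·Σ_{k=1}^{n} w(k) for all n ∈ ℤ⁺, for some constant c > 0. Then there exists ε with 0 < ε < 1/(2(c+1)·max{1/p, 1}) such that w belongs to B_{p−ε}, i.e. there exists a constant c' > 0 with Σ_{k=n}^{∞} (n/k)^{p−ε} w(k) ≤ c'·Σ_{k=1}^{n} w(k) for all n ∈ ℤ⁺. -/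
/-- Bernoulli-type lower bound for real powers. -/
theorem one_add_mul_one_sub_inv_le_rpow {x s : ℝ} (hx : 0 < x) (hs : 0 ≤ s) :
    1 + s * (1 - x⁻¹) ≤ x ^ s := by
  have h1 := Real.one_sub_inv_le_log_of_pos hx
  have h2 := Real.add_one_le_exp (Real.log x * s)
  rw [Real.rpow_def_of_pos hx]
  nlinarith [mul_le_mul_of_nonneg_left h1 hs]

/-- Summation by parts. -/
theorem sum_Ico_mul_sub_succ (f T : ℕ → ℝ) {n N : ℕ} (h : n ≤ N) :
    ∑ k ∈ Finset.Ico n N, f k * (T k - T (k + 1)) =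
      f n * T n + ∑ k ∈ Finset.Ico n N, (f (k + 1) - f k) * T (k + 1) - f N * T N := by
  induction N, h using Nat.le_induction with
  | base => simp
  | succ N h ih =>
    rw [Finset.sum_Ico_succ_top h, Finset.sum_Ico_succ_top h, ih]
    ring

theorem rpow_add_one_sub_rpow_mul_le {p ε x : ℝ} (hε : 0 < ε) (hεp : ε < p) (hx : 1 ≤ x) :
    ((x + 1) ^ ε - x ^ ε) * (x + 1) ^ (-p) ≤
      2 * ε / (p - ε) * (x ^ (-(p - ε)) - (x + 1) ^ (-(p - ε))) := by
  have hx0 : 0 < x := by linarith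
  have hx1 : 0 < x + 1 := by linarith
  have hq : 0 < p - ε := by linarith
  have hA : (x + 1) ^ ε * (x + 1) ^ (-p) = (x + 1) ^ (-(p - ε)) := by
    rw [← Real.rpow_add hx1]
    ring_nf
  have hB : x ^ ε = (x + 1) ^ ε * (x / (x + 1)) ^ ε := by
    rw [← Real.mul_rpow hx1.le (by positivity), mul_div_cancel₀ _ hx1.ne']
  have hC : x ^ (-(p - ε)) = (x + 1) ^ (-(p - ε)) * ((x + 1) / x) ^ (p - ε) := by
    rw [Real.div_rpow hx1.le hx0.le, Real.rpow_neg hx1.le, Real.rpow_neg hx0.le]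
    have := (Real.rpow_pos_of_pos hx1 (p - ε)).ne'
    field_simp
  have h1 := one_add_mul_one_sub_inv_le_rpow (div_pos hx0 hx1) hε.le
  have h2 := one_add_mul_one_sub_inv_le_rpow (div_pos hx1 hx0) hq.le
  rw [inv_div] at h1 h2
  have hG : 0 < (x + 1) ^ (-(p - ε)) := Real.rpow_pos_of_pos hx1 _
  have hL : 1 - (x / (x + 1)) ^ ε ≤ ε / x := by
    have : 1 - (x + 1) / x = -(1 / x) := by field_simp; ring
    rw [this] at h1
    have : ε / x = ε * (1 / x) := by ring
    linarith
  have hR : (p - ε) / (x + 1) ≤ ((x + 1) / x) ^ (p - ε) - 1 := by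
    have : 1 - x / (x + 1) = 1 / (x + 1) := by field_simp; ring
    rw [this] at h2
    have : (p - ε) / (x + 1) = (p - ε) * (1 / (x + 1)) := by ring
    linarith
  calc ((x + 1) ^ ε - x ^ ε) * (x + 1) ^ (-p)
      = (x + 1) ^ (-(p - ε)) * (1 - (x / (x + 1)) ^ ε) := by rw [← hA, hB]; ring
    _ ≤ (x + 1) ^ (-(p - ε)) * (2 * ε / (p - ε) * ((p - ε) / (x + 1))) := by
        refine mul_le_mul_of_nonneg_left (hL.trans ?_) hG.le
        have : 2 * ε / (p - ε) * ((p - ε) / (x + 1)) = 2 * ε / (x + 1) := by field_simp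
        rw [this, div_le_div_iff₀ hx0 hx1]
        nlinarith
    _ ≤ (x + 1) ^ (-(p - ε)) * (2 * ε / (p - ε) * (((x + 1) / x) ^ (p - ε) - 1)) := by
        gcongr
    _ = 2 * ε / (p - ε) * (x ^ (-(p - ε)) - (x + 1) ^ (-(p - ε))) := by rw [hC]; ring

theorem rpow_neg_le_two_rpow_mul {q x : ℝ} (hq : 0 < q) (hx : 1 ≤ x) :
    x ^ (-q) ≤ 2 ^ q * (x + 1) ^ (-q) := by
  have hx0 : 0 < x := by linarith
  have h : ((2 : ℝ) * x) ^ (-q) ≤ (x + 1) ^ (-q) :=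
    Real.rpow_le_rpow_of_nonpos (by linarith) (by linarith) (by linarith)
  rw [Real.mul_rpow (by norm_num) hx0.le] at h
  have h2 : (0 : ℝ) < 2 ^ q := by positivity
  have h3 : (2 : ℝ) ^ q * 2 ^ (-q) = 1 := by
    rw [← Real.rpow_add (by norm_num)]; simp
  calc x ^ (-q) = 2 ^ q * (2 ^ (-q) * x ^ (-q)) := by rw [← mul_assoc, h3, one_mul]
    _ ≤ _ := by gcongr

/-- The self-improvement estimate for truncated sums. -/
theorem sum_Ico_rpow_mul_le {p ε c : ℝ} (hε : 0 < ε) (hεp : 2 * ε ≤ p) (hc : 0 < c)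
    (hεc : ε * (8 * c * 2 ^ p) ≤ p) {w : ℕ → ℝ} (hw : ∀ k, 0 ≤ w k)
    (hB : ∀ n N : ℕ, 1 ≤ n → ∑ k ∈ Finset.Ico n N, (k : ℝ) ^ (-p) * w k ≤
      c * (n : ℝ) ^ (-p) * ∑ k ∈ Finset.Icc 1 n, w k)
    {n M : ℕ} (hn : 1 ≤ n) (hnM : n ≤ M) :
    ∑ k ∈ Finset.Ico n (M + 1), (k : ℝ) ^ (-(p - ε)) * w k ≤
      6 * c * (n : ℝ) ^ (-(p - ε)) * ∑ k ∈ Finset.Icc 1 n, w k := by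
  have hp : 0 < p := by linarith
  have hq : 0 < p - ε := by linarith
  set g : ℕ → ℝ := fun k => (k : ℝ) ^ (-(p - ε)) with hg
  set f : ℕ → ℝ := fun k => (k : ℝ) ^ ε with hf
  set S : ℕ → ℝ := fun m => ∑ k ∈ Finset.Icc 1 m, w k with hS
  set T : ℕ → ℝ := fun m => ∑ k ∈ Finset.Ico m (M + 1), (k : ℝ) ^ (-p) * w k with hT
  set X : ℝ := ∑ k ∈ Finset.Ico n (M + 1), g k * w k with hX
  set δ : ℝ := 2 * ε / (p - ε) with hδ
  have hg0 : ∀ k, 0 ≤ g k := fun k => by positivity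
  have hf0 : ∀ k, 0 ≤ f k := fun k => by positivity
  have hS0 : ∀ k, 0 ≤ S k := fun k => Finset.sum_nonneg fun i _ => hw i
  have hδ0 : 0 ≤ δ := by positivity
  have hfg : ∀ k : ℕ, 1 ≤ k → f k * (k : ℝ) ^ (-p) = g k := by
    intro k hk
    have : (0 : ℝ) < k := by exact_mod_cast hk
    simp only [hf, hg]
    rw [← Real.rpow_add this]
    ring_nf
  have hSs : ∀ m, S (m + 1) = S m + w (m + 1) := fun m =>
    Finset.sum_Icc_succ_top (by omega) _
  have hTN : T (M + 1) = 0 := by simp [hT]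
  have hX1 : X = f n * T n + ∑ i ∈ Finset.Ico n M, (f (i + 1) - f i) * T (i + 1) := by
    have h := sum_Ico_mul_sub_succ f T (Nat.le_succ_of_le hnM : n ≤ M + 1)
    rw [hTN, Finset.sum_Ico_succ_top hnM (fun i => (f (i + 1) - f i) * T (i + 1)), hTN] at h
    simp only [mul_zero, add_zero, sub_zero] at h
    rw [hX, ← h]
    refine Finset.sum_congr rfl fun k hk => ?_
    rw [Finset.mem_Ico] at hk
    have : T k = (k : ℝ) ^ (-p) * w k + T (k + 1) := Finset.sum_eq_sum_Ico_succ_bot hk.2 _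
    rw [this, ← hfg k (by omega)]
    ring
  have hterm : ∀ i ∈ Finset.Ico n M,
      (f (i + 1) - f i) * T (i + 1) ≤ c * δ * ((g i - g (i + 1)) * S (i + 1)) := by
    intro i hi
    rw [Finset.mem_Ico] at hi
    have hi1 : (1 : ℝ) ≤ i := by exact_mod_cast hn.trans hi.1
    have h1 := rpow_add_one_sub_rpow_mul_le hε (by linarith : ε < p) hi1
    have hmono : 0 ≤ f (i + 1) - f i := by
      simp only [hf, sub_nonneg]
      exact Real.rpow_le_rpow (by linarith) (by push_cast; linarith) hε.le
    calc (f (i + 1) - f i) * T (i + 1)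
        ≤ (f (i + 1) - f i) * (c * ((i + 1 : ℕ) : ℝ) ^ (-p) * S (i + 1)) :=
          mul_le_mul_of_nonneg_left (hB (i + 1) (M + 1) (by omega)) hmono
      _ = c * S (i + 1) * ((f (i + 1) - f i) * ((i + 1 : ℕ) : ℝ) ^ (-p)) := by ring
      _ ≤ c * S (i + 1) * (δ * (g i - g (i + 1))) := by
          refine mul_le_mul_of_nonneg_left ?_ (mul_nonneg hc.le (hS0 _))
          simpa only [hf, hg, hδ, Nat.cast_add, Nat.cast_one] using h1
      _ = _ := by ring
  have hparts : ∑ i ∈ Finset.Ico n M, (g i - g (i + 1)) * S (i + 1) ≤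
      g n * S n + ∑ i ∈ Finset.Ico n M, g i * w (i + 1) := by
    have h := sum_Ico_mul_sub_succ g S hnM
    have h1 : ∑ i ∈ Finset.Ico n M, (g i - g (i + 1)) * S (i + 1) =
        -∑ i ∈ Finset.Ico n M, (g (i + 1) - g i) * S (i + 1) := by
      rw [← Finset.sum_neg_distrib]
      exact Finset.sum_congr rfl fun i _ => by ring
    have h2 : ∑ i ∈ Finset.Ico n M, g i * w (i + 1) =
        -∑ i ∈ Finset.Ico n M, g i * (S i - S (i + 1)) := by
      rw [← Finset.sum_neg_distrib]
      exact Finset.sum_congr rfl fun i _ => by rw [hSs]; ring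
    linarith [mul_nonneg (hg0 M) (hS0 M)]
  have hshift : ∑ i ∈ Finset.Ico n M, g i * w (i + 1) ≤ 2 ^ p * X := by
    calc ∑ i ∈ Finset.Ico n M, g i * w (i + 1)
        ≤ ∑ i ∈ Finset.Ico n M, 2 ^ p * (g (i + 1) * w (i + 1)) := by
          refine Finset.sum_le_sum fun i hi => ?_
          rw [Finset.mem_Ico] at hi
          have hi1 : (1 : ℝ) ≤ i := by exact_mod_cast hn.trans hi.1
          have h1 := rpow_neg_le_two_rpow_mul hq hi1
          have h2 : (2 : ℝ) ^ (p - ε) ≤ 2 ^ p :=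
            Real.rpow_le_rpow_of_exponent_le (by norm_num) (by linarith)
          have h3 : g i ≤ 2 ^ (p - ε) * g (i + 1) := by
            simpa only [hg, Nat.cast_add, Nat.cast_one] using h1
          rw [← mul_assoc]
          exact mul_le_mul_of_nonneg_right
            (h3.trans (mul_le_mul_of_nonneg_right h2 (hg0 _))) (hw _)
      _ = 2 ^ p * ∑ i ∈ Finset.Ico (n + 1) (M + 1), g i * w i := by
          rw [← Finset.mul_sum, Finset.sum_Ico_add' (fun i => g i * w i)]
      _ ≤ 2 ^ p * X := by
          refine mul_le_mul_of_nonneg_left ?_ (by positivity)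
          exact Finset.sum_le_sum_of_subset_of_nonneg
            (Finset.Ico_subset_Ico_left (Nat.le_succ n))
            fun i _ _ => mul_nonneg (hg0 i) (hw i)
  have hhead : f n * T n ≤ c * (g n * S n) := by
    calc f n * T n ≤ f n * (c * (n : ℝ) ^ (-p) * S n) :=
          mul_le_mul_of_nonneg_left (hB n (M + 1) hn) (hf0 n)
      _ = c * ((f n * (n : ℝ) ^ (-p)) * S n) := by ring
      _ = _ := by rw [hfg n hn]
  have hmain : X ≤ c * (g n * S n) + c * δ * (g n * S n + 2 ^ p * X) := by
    have h1 := Finset.sum_le_sum hterm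
    rw [← Finset.mul_sum] at h1
    have h2 := mul_le_mul_of_nonneg_left (hparts.trans (add_le_add_right hshift (g n * S n)))
      (mul_nonneg hc.le hδ0)
    linarith
  have hX0 : 0 ≤ X := Finset.sum_nonneg fun i _ => mul_nonneg (hg0 i) (hw i)
  have hδ2 : δ ≤ 2 := by
    rw [hδ, div_le_iff₀ hq]; linarith
  have hδc : c * δ * 2 ^ p ≤ 1 / 2 := by
    have : c * δ * 2 ^ p = (2 * ε * c * 2 ^ p) / (p - ε) := by rw [hδ]; ring
    rw [this, div_le_iff₀ hq]
    linarith
  have hgS : 0 ≤ c * (g n * S n) := mul_nonneg hc.le (mul_nonneg (hg0 n) (hS0 n))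
  have h1 := mul_le_mul_of_nonneg_right hδc hX0
  have h2 := mul_le_mul_of_nonneg_right hδ2 hgS
  show X ≤ 6 * c * g n * S n
  nlinarith

theorem div_rpow_add_eq {n : ℕ} (hn : 1 ≤ n) (j : ℕ) (s : ℝ) :
    ((n : ℝ) / ((n : ℝ) + j)) ^ s = (n : ℝ) ^ s * ((n + j : ℕ) : ℝ) ^ (-s) := by
  have h1 : (0 : ℝ) < n := by exact_mod_cast hn
  have h2 : (0 : ℝ) < (n : ℝ) + j := by positivity
  rw [Real.div_rpow h1.le h2.le, Nat.cast_add, Real.rpow_neg h2.le, div_eq_mul_inv]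

/-- A bound on the weighted tail series amounts to a uniform bound on its truncations. -/
theorem tsum_ofReal_div_rpow_mul_le_iff {w : ℕ → ℝ} (hw : ∀ k, 0 ≤ w k) {n : ℕ} (hn : 1 ≤ n)
    (s : ℝ) {B : ℝ} (hB : 0 ≤ B) :
    ∑' j : ℕ, ENNReal.ofReal (((n : ℝ) / ((n : ℝ) + j)) ^ s * w (n + j)) ≤ ENNReal.ofReal B ↔
      ∀ N : ℕ, ∑ k ∈ Finset.Ico n N, (k : ℝ) ^ (-s) * w k ≤ (n : ℝ) ^ (-s) * B := by
  have hn0 : (0 : ℝ) < n := by exact_mod_cast hn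
  have hsum : ∀ m : ℕ,
      ∑ j ∈ Finset.range m, ENNReal.ofReal (((n : ℝ) / ((n : ℝ) + j)) ^ s * w (n + j)) ≤
        ENNReal.ofReal B ↔
      ∑ k ∈ Finset.Ico n (n + m), (k : ℝ) ^ (-s) * w k ≤ (n : ℝ) ^ (-s) * B := by
    intro m
    rw [← ENNReal.ofReal_sum_of_nonneg fun j _ => mul_nonneg (by positivity) (hw _),
      ENNReal.ofReal_le_ofReal_iff hB, Finset.sum_Ico_eq_sum_range, Nat.add_sub_cancel_left,
      Real.rpow_neg hn0.le, le_inv_mul_iff₀ (Real.rpow_pos_of_pos hn0 s), Finset.mul_sum]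
    simp only [div_rpow_add_eq hn, mul_assoc]
  constructor
  · intro h N
    rcases le_total n N with hN | hN
    · obtain ⟨m, rfl⟩ := Nat.exists_eq_add_of_le hN
      exact (hsum m).1 ((ENNReal.sum_le_tsum _).trans h)
    · rw [Finset.Ico_eq_empty_of_le hN, Finset.sum_empty]
      positivity
  · intro h
    exact ENNReal.tsum_le_of_sum_range_le fun m => (hsum m).2 (h (n + m))

/-- Open-ended property of the Ariño–Muckenhoupt class `B_p`: if a non-negative sequence `w`
satisfies `Σ_{k=n}^∞ (n/k)^p w(k) ≤ c Σ_{k=1}^n w(k)` for all `n ∈ ℤ⁺`, then there exists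
`0 < ε < 1/(2(c+1) max{1/p,1})` such that `w ∈ B_{p−ε}`. -/
theorem stmt_9 (p : ℝ) (hp : 0 < p)
    (w : ℕ → ℝ) (hw : ∀ k, 0 ≤ w k) (c : ℝ) (hc : 0 < c)
    (hBp : ∀ n : ℕ, 1 ≤ n →
      ∑' j : ℕ, ENNReal.ofReal (((n : ℝ) / ((n : ℝ) + j)) ^ p * w (n + j)) ≤
        ENNReal.ofReal (c * ∑ k ∈ Finset.Icc 1 n, w k)) :
    ∃ ε : ℝ, 0 < ε ∧ ε < 1 / (2 * (c + 1) * max (1 / p) 1) ∧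
      ∃ c' : ℝ, 0 < c' ∧ ∀ n : ℕ, 1 ≤ n →
        ∑' j : ℕ, ENNReal.ofReal (((n : ℝ) / ((n : ℝ) + j)) ^ (p - ε) * w (n + j)) ≤
          ENNReal.ofReal (c' * ∑ k ∈ Finset.Icc 1 n, w k) := by
  have h2p : (0 : ℝ) < 2 ^ p := by positivity
  have hb : 0 < 1 / (2 * (c + 1) * max (1 / p) 1) := by
    have : 0 < max (1 / p) 1 := lt_max_of_lt_right one_pos
    positivity
  set b := 1 / (2 * (c + 1) * max (1 / p) 1)
  obtain ⟨ε, hε, hεmin⟩ : ∃ ε : ℝ, 0 < ε ∧ ε < min b (min (p / 2) (p / (8 * c * 2 ^ p))) :=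
    exists_between (lt_min hb (lt_min (by positivity) (by positivity)))
  simp only [lt_min_iff] at hεmin
  obtain ⟨hεb, hεp, hεc⟩ := hεmin
  have hS0 : ∀ n, 0 ≤ ∑ k ∈ Finset.Icc 1 n, w k := fun n => Finset.sum_nonneg fun i _ => hw i
  refine ⟨ε, hε, hεb, 6 * c, by positivity, fun n hn => ?_⟩
  have hn0 : (0 : ℝ) ≤ (n : ℝ) ^ (-(p - ε)) := by positivity
  rw [tsum_ofReal_div_rpow_mul_le_iff hw hn _ (mul_nonneg (by positivity) (hS0 n))]
  intro N
  rcases lt_or_ge n N with hN | hN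
  · obtain ⟨M, rfl⟩ : ∃ M, N = M + 1 := ⟨N - 1, by omega⟩
    refine (sum_Ico_rpow_mul_le hε (by linarith) hc ?_ hw ?_ hn (by omega : n ≤ M)).trans_eq
      (by ring)
    · exact ((lt_div_iff₀ (by positivity)).1 hεc).le
    · intro m K hm
      refine ((tsum_ofReal_div_rpow_mul_le_iff hw hm p (mul_nonneg hc.le (hS0 m))).1
        (hBp m hm) K).trans_eq (by ring)
  · rw [Finset.Ico_eq_empty_of_le hN, Finset.sum_empty]
    exact mul_nonneg hn0 (mul_nonneg (by positivity) (hS0 n))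
end

section
/- Let β ≥ 0, p₀ > 0 and 0 < ε < p₀(β+1), and let v : ℤ⁺ → ℝ be a non-negative non-increasing sequence. Then the weight sequence w(k) = v(k)·k^{p₀−1−ε} satisfies Σ_{k=n}^{∞} (n/k)^{p₀} w(k) ≤ c(β,p₀,ε)·Σ_{k=1}^{n} (k/n)^{βp₀} w(k) for all n ∈ ℤ⁺, where c(β,p₀,ε) = (1 + 1/ε)·max{p₀(1+β)−ε, 1}; in particular, w belongs to the class QB_{β,p₀}. -/
theorem Real.rpow_sub_rpow_sub_one_le {a x : ℝ} (ha : 1 ≤ a) (hx : 1 ≤ x) :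
    x ^ a - (x - 1) ^ a ≤ a * x ^ (a - 1) := by
  have hx0 : 0 < x := by linarith
  have hinv : x⁻¹ ≤ 1 := inv_le_one_of_one_le₀ hx
  have bernoulli := one_add_mul_self_le_rpow_one_add (s := -x⁻¹) (by linarith) ha
  have hfac : (x - 1) ^ a = x ^ a * (1 + -x⁻¹) ^ a := by
    rw [← Real.mul_rpow hx0.le (by linarith)]
    congr 1
    field_simp
    ring
  rw [hfac, Real.rpow_sub_one hx0.ne']
  have hmul := mul_le_mul_of_nonneg_left bernoulli (Real.rpow_nonneg hx0.le a)
  have hexpand : x ^ a * (1 + a * -x⁻¹) = x ^ a - a * (x ^ a / x) := by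
    rw [div_eq_mul_inv]
    ring
  linarith

theorem Real.mul_rpow_neg_one_sub_le {ε x : ℝ} (hε : 0 ≤ ε) (hx : 0 < x) :
    ε * (x + 1) ^ (-1 - ε) ≤ x ^ (-ε) - (x + 1) ^ (-ε) := by
  have hx1 : 0 < x + 1 := by linarith
  set y := x / (x + 1) with hy
  have hy0 : 0 < y := div_pos hx hx1
  have hbern : 1 + ε * (1 - y) ≤ y ^ (-ε) := by
    rw [Real.rpow_def_of_pos hy0]
    have hexp := Real.add_one_le_exp (Real.log y * -ε)
    nlinarith [mul_le_mul_of_nonneg_left (Real.log_le_sub_one_of_pos hy0) hε]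
  have hfac : x ^ (-ε) = (x + 1) ^ (-ε) * y ^ (-ε) := by
    rw [← Real.mul_rpow hx1.le hy0.le, hy, mul_div_cancel₀ _ hx1.ne']
  have hpow : (x + 1) ^ (-1 - ε) = (x + 1) ^ (-ε) * (1 - y) := by
    rw [show -1 - ε = -ε - 1 by ring, Real.rpow_sub_one hx1.ne', hy]
    field_simp
    ring
  rw [hfac, hpow]
  nlinarith [mul_le_mul_of_nonneg_left hbern (Real.rpow_nonneg hx1.le (-ε))]

theorem Real.rpow_le_max_mul_sum_rpow {a : ℝ} (ha : 0 < a) (n : ℕ) :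
    (n : ℝ) ^ a ≤ max a 1 * ∑ k ∈ Finset.Icc 1 n, (k : ℝ) ^ (a - 1) := by
  rcases le_total 1 a with h | h
  · rw [max_eq_left h]
    induction n with
    | zero => simp [Real.zero_rpow ha.ne']
    | succ m ih =>
      rw [Finset.sum_Icc_succ_top (by omega), mul_add]
      have hstep := Real.rpow_sub_rpow_sub_one_le h (x := ((m + 1 : ℕ) : ℝ)) (by simp)
      have hpred : ((m + 1 : ℕ) : ℝ) - 1 = m := by simp
      rw [hpred] at hstep
      linarith
  · rw [max_eq_right h, one_mul]
    rcases Nat.eq_zero_or_pos n with rfl | hn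
    · simp [Real.zero_rpow ha.ne']
    · have hn0 : (0 : ℝ) < n := by exact_mod_cast hn
      calc (n : ℝ) ^ a = ∑ _k ∈ Finset.Icc 1 n, (n : ℝ) ^ (a - 1) := by
            rw [Finset.sum_const, Nat.card_Icc, Real.rpow_sub_one hn0.ne', nsmul_eq_mul,
              Nat.add_sub_cancel]
            field_simp
        _ ≤ _ := by
            refine Finset.sum_le_sum fun k hk => ?_
            obtain ⟨hk1, hkn⟩ := Finset.mem_Icc.1 hk
            exact Real.rpow_le_rpow_of_nonpos (by exact_mod_cast hk1) (by exact_mod_cast hkn)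
              (by linarith)

theorem Real.sum_range_rpow_neg_one_sub_le {ε x : ℝ} (hε : 0 < ε) (hx : 1 ≤ x) (m : ℕ) :
    ∑ j ∈ Finset.range m, (x + j) ^ (-1 - ε) ≤ (1 + 1 / ε) * x ^ (-ε) := by
  have hx0 : 0 < x := by linarith
  have htelescope : ∀ m : ℕ, ε * ∑ j ∈ Finset.range (m + 1), (x + j) ^ (-1 - ε) ≤
      ε * x ^ (-1 - ε) + (x ^ (-ε) - (x + m) ^ (-ε)) := by
    intro m
    induction m with
    | zero => simp
    | succ m ih =>
      rw [Finset.sum_range_succ, mul_add]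
      have hstep := Real.mul_rpow_neg_one_sub_le hε.le (x := x + m) (by positivity)
      push_cast
      rw [← add_assoc]
      linarith
  have hfirst : x ^ (-1 - ε) ≤ x ^ (-ε) := Real.rpow_le_rpow_of_exponent_le hx (by linarith)
  have hlast : 0 ≤ (x + m) ^ (-ε) := by positivity
  calc ∑ j ∈ Finset.range m, (x + j) ^ (-1 - ε)
      ≤ ∑ j ∈ Finset.range (m + 1), (x + j) ^ (-1 - ε) := by
        rw [Finset.sum_range_succ]
        exact le_add_of_nonneg_right (by positivity)
    _ ≤ (ε * x ^ (-ε) + x ^ (-ε)) / ε := by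
        rw [le_div_iff₀ hε, mul_comm]
        nlinarith [htelescope m]
    _ = (1 + 1 / ε) * x ^ (-ε) := by
        field_simp

theorem sum_range_div_rpow_mul_le {p ε : ℝ} (hε : 0 < ε) {v : ℕ → ℝ} (hv : ∀ k, 0 ≤ v k)
    (hmono : ∀ j k : ℕ, 1 ≤ j → j ≤ k → v k ≤ v j) {n : ℕ} (hn : 1 ≤ n) (m : ℕ) :
    ∑ j ∈ Finset.range m,
        ((n : ℝ) / ((n : ℝ) + j)) ^ p * (v (n + j) * ((n : ℝ) + j) ^ (p - 1 - ε)) ≤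
      (1 + 1 / ε) * (v n * (n : ℝ) ^ (p - ε)) := by
  have hn1 : (1 : ℝ) ≤ n := by exact_mod_cast hn
  have hn0 : (0 : ℝ) < n := by linarith
  calc _ ≤ ∑ j ∈ Finset.range m, v n * (n : ℝ) ^ p * ((n : ℝ) + j) ^ (-1 - ε) := by
        refine Finset.sum_le_sum fun j _ => ?_
        have hj0 : (0 : ℝ) < n + j := by positivity
        have hterm : ((n : ℝ) / ((n : ℝ) + j)) ^ p * (v (n + j) * ((n : ℝ) + j) ^ (p - 1 - ε)) =
            v (n + j) * (n : ℝ) ^ p * ((n : ℝ) + j) ^ (-1 - ε) := by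
          rw [Real.div_rpow hn0.le hj0.le, show p - 1 - ε = p + (-1 - ε) by ring,
            Real.rpow_add hj0]
          field_simp
        rw [hterm]
        gcongr
        exact hmono n (n + j) hn (Nat.le_add_right n j)
    _ ≤ v n * (n : ℝ) ^ p * ((1 + 1 / ε) * (n : ℝ) ^ (-ε)) := by
        rw [← Finset.mul_sum]
        exact mul_le_mul_of_nonneg_left (Real.sum_range_rpow_neg_one_sub_le hε hn1 m)
          (mul_nonneg (hv n) (by positivity))
    _ = _ := by
        rw [sub_eq_add_neg p ε, Real.rpow_add hn0]
        ring

theorem mul_rpow_le_max_mul_sum {β p ε : ℝ} (hε : ε < p * (β + 1)) {v : ℕ → ℝ}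
    (hv : ∀ k, 0 ≤ v k) (hmono : ∀ j k : ℕ, 1 ≤ j → j ≤ k → v k ≤ v j) {n : ℕ} (hn : 1 ≤ n) :
    v n * (n : ℝ) ^ (p - ε) ≤ max (p * (1 + β) - ε) 1 *
      ∑ k ∈ Finset.Icc 1 n, ((k : ℝ) / n) ^ (β * p) * (v k * (k : ℝ) ^ (p - 1 - ε)) := by
  have hn0 : (0 : ℝ) < n := by exact_mod_cast hn
  have ha : 0 < p * (1 + β) - ε := by linarith
  calc v n * (n : ℝ) ^ (p - ε)
      = v n / (n : ℝ) ^ (β * p) * (n : ℝ) ^ (p * (1 + β) - ε) := by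
        rw [show p * (1 + β) - ε = β * p + (p - ε) by ring, Real.rpow_add hn0]
        field_simp
    _ ≤ v n / (n : ℝ) ^ (β * p) * (max (p * (1 + β) - ε) 1 *
          ∑ k ∈ Finset.Icc 1 n, (k : ℝ) ^ (p * (1 + β) - ε - 1)) :=
        mul_le_mul_of_nonneg_left (Real.rpow_le_max_mul_sum_rpow ha n)
          (div_nonneg (hv n) (by positivity))
    _ = max (p * (1 + β) - ε) 1 *
          ∑ k ∈ Finset.Icc 1 n, v n / (n : ℝ) ^ (β * p) * (k : ℝ) ^ (p * (1 + β) - ε - 1) := by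
        rw [← Finset.mul_sum]
        ring
    _ ≤ _ := by
        refine mul_le_mul_of_nonneg_left (Finset.sum_le_sum fun k hk => ?_) (by positivity)
        obtain ⟨hk1, hkn⟩ := Finset.mem_Icc.1 hk
        have hk0 : (0 : ℝ) < k := by exact_mod_cast hk1
        have hterm : ((k : ℝ) / n) ^ (β * p) * (v k * (k : ℝ) ^ (p - 1 - ε)) =
            v k / (n : ℝ) ^ (β * p) * (k : ℝ) ^ (p * (1 + β) - ε - 1) := by
          rw [Real.div_rpow hk0.le hn0.le,
            show p * (1 + β) - ε - 1 = β * p + (p - 1 - ε) by ring, Real.rpow_add hk0]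
          ring
        rw [hterm]
        gcongr
        exact hmono k n hk1 hkn


/-- Membership in the discrete weight class `QB_{β,p}`:
`Σ_{k=n}^∞ (n/k)^p w(k) ≤ c Σ_{k=1}^n (k/n)^{βp} w(k)` for all `n ∈ ℤ⁺`, for some `c > 0`. -/
def memQB (β p : ℝ) (w : ℕ → ℝ) : Prop :=
  ∃ c : ℝ, 0 < c ∧ ∀ n : ℕ, 1 ≤ n →
    ∑' j : ℕ, ENNReal.ofReal (((n : ℝ) / ((n : ℝ) + j)) ^ p * w (n + j)) ≤
      ENNReal.ofReal (c * ∑ k ∈ Finset.Icc 1 n, ((k : ℝ) / n) ^ (β * p) * w k)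

/-- For a non-negative non-increasing sequence `v`, the weight `w(k) = v(k) k^{p₀−1−ε}`
satisfies the `QB_{β,p₀}` inequality with constant `c(β,p₀,ε) = (1+1/ε) max{p₀(1+β)−ε, 1}`;
in particular it belongs to `QB_{β,p₀}`. -/
theorem stmt_12 (β p₀ ε : ℝ) (hβ : 0 ≤ β) (hp₀ : 0 < p₀)
    (hε0 : 0 < ε) (hε : ε < p₀ * (β + 1))
    (v : ℕ → ℝ) (hv : ∀ k, 0 ≤ v k)
    (hmono : ∀ j k : ℕ, 1 ≤ j → j ≤ k → v k ≤ v j) :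
    (∀ n : ℕ, 1 ≤ n →
      ∑' j : ℕ, ENNReal.ofReal
          (((n : ℝ) / ((n : ℝ) + j)) ^ p₀ * (v (n + j) * ((n : ℝ) + j) ^ (p₀ - 1 - ε))) ≤
        ENNReal.ofReal ((1 + 1 / ε) * max (p₀ * (1 + β) - ε) 1 *
          ∑ k ∈ Finset.Icc 1 n, ((k : ℝ) / n) ^ (β * p₀) * (v k * (k : ℝ) ^ (p₀ - 1 - ε)))) ∧
    memQB β p₀ (fun k => v k * (k : ℝ) ^ (p₀ - 1 - ε)) := by
  have hbound : ∀ n : ℕ, 1 ≤ n →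
      ∑' j : ℕ, ENNReal.ofReal
          (((n : ℝ) / ((n : ℝ) + j)) ^ p₀ * (v (n + j) * ((n : ℝ) + j) ^ (p₀ - 1 - ε))) ≤
        ENNReal.ofReal ((1 + 1 / ε) * max (p₀ * (1 + β) - ε) 1 *
          ∑ k ∈ Finset.Icc 1 n, ((k : ℝ) / n) ^ (β * p₀) * (v k * (k : ℝ) ^ (p₀ - 1 - ε))) := by
    intro n hn
    refine ENNReal.tsum_le_of_sum_range_le fun m => ?_
    rw [← ENNReal.ofReal_sum_of_nonneg fun j _ =>
      mul_nonneg (by positivity) (mul_nonneg (hv _) (by positivity))]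
    refine ENNReal.ofReal_le_ofReal
      ((sum_range_div_rpow_mul_le hε0 hv hmono hn m).trans ?_)
    rw [mul_assoc]
    exact mul_le_mul_of_nonneg_left (mul_rpow_le_max_mul_sum hε hv hmono hn) (by positivity)
  refine ⟨hbound, (1 + 1 / ε) * max (p₀ * (1 + β) - ε) 1, by positivity, fun n hn => ?_⟩
  simpa only [Nat.cast_add] using hbound n hn
end

section
/- Let p > 0, β > −1, and let w : ℤ⁺ → ℝ be a non-negative sequence satisfying Σ_{k=n}^{∞} (n/k)^p w(k) ≤ c·Σ_{k=1}^{n} (k/n)^{βp} w(k) for all n ∈ ℤ⁺, for some constant c > 0. Then for all n ∈ ℤ⁺, n^{p+βp}·Σ_{k=n}^{∞} k^{−(p+βp+1)}·(Σ_{i=1}^{k} i^{βp} w(i)) ≤ 2(c+1)·max{1/(p+βp), 1}·Σ_{k=1}^{n} k^{βp} w(k). -/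
/-- A telescoping bound for `(x + 1) ^ (-(s + 1))`, the discrete form of `∫ t ^ (-(s + 1))`. -/
theorem mul_rpow_neg_add_one_le_sub {s x : ℝ} (hs : 0 < s) (hx : 0 < x) :
    s * (x + 1) ^ (-(s + 1)) ≤ x ^ (-s) - (x + 1) ^ (-s) := by
  have hx1 : 0 < x + 1 := by linarith
  have hlog : 1 / (x + 1) ≤ Real.log ((x + 1) / x) := by
    have h := Real.log_le_sub_one_of_pos (div_pos hx hx1)
    have h2 : Real.log ((x + 1) / x) = - Real.log (x / (x + 1)) := by
      rw [← Real.log_inv, inv_div]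
    have h3 : x / (x + 1) - 1 = -(1 / (x + 1)) := by field_simp; ring
    linarith
  have hB : 1 + s * (1 / (x + 1)) ≤ ((x + 1) / x) ^ s := by
    rw [Real.rpow_def_of_pos (div_pos hx1 hx)]
    have := Real.add_one_le_exp (Real.log ((x + 1) / x) * s)
    nlinarith
  have hmul : x ^ (-s) = (x + 1) ^ (-s) * ((x + 1) / x) ^ s := by
    rw [Real.div_rpow hx1.le hx.le, Real.rpow_neg hx.le, Real.rpow_neg hx1.le]
    field_simp
  have hexp : (x + 1) ^ (-(s + 1)) = (x + 1) ^ (-s) * (1 / (x + 1)) := by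
    rw [neg_add, Real.rpow_add hx1, Real.rpow_neg_one, one_div]
  have hpos : 0 < (x + 1) ^ (-s) := Real.rpow_pos_of_pos hx1 _
  rw [hmul, hexp]
  nlinarith [mul_le_mul_of_nonneg_left hB hpos.le]

theorem sum_range_rpow_neg_add_one_le {s x : ℝ} (hs : 0 < s) (hx : 0 < x) (N : ℕ) :
    ∑ j ∈ Finset.range (N + 1), (x + j) ^ (-(s + 1)) ≤
      x ^ (-(s + 1)) + (x ^ (-s) - (x + N) ^ (-s)) / s := by
  induction N with
  | zero => simp
  | succ N ih =>
    rw [Finset.sum_range_succ]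
    have h := mul_rpow_neg_add_one_le_sub hs (x := x + N) (by positivity)
    have h2 : (x + N + 1) ^ (-(s + 1)) ≤ ((x + N) ^ (-s) - (x + N + 1) ^ (-s)) / s := by
      rw [le_div_iff₀ hs]; linarith
    push_cast
    rw [← add_assoc]
    have h3 : (x ^ (-s) - (x + N + 1) ^ (-s)) / s = (x ^ (-s) - (x + N) ^ (-s)) / s +
      ((x + N) ^ (-s) - (x + N + 1) ^ (-s)) / s := by ring
    linarith

/-- Tail bound for the `p`-series with exponent `s + 1`. -/
theorem tsum_rpow_neg_add_one_le {s x : ℝ} (hs : 0 < s) (hx : 1 ≤ x) :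
    ∑' j : ℕ, ENNReal.ofReal ((x + j) ^ (-(s + 1))) ≤
      ENNReal.ofReal (2 * max (1 / s) 1 * x ^ (-s)) := by
  have hx0 : 0 < x := by linarith
  refine ENNReal.tsum_le_of_sum_range_le fun N => ?_
  rw [← ENNReal.ofReal_sum_of_nonneg fun j _ => by positivity]
  refine ENNReal.ofReal_le_ofReal ?_
  have hmono : ∑ j ∈ Finset.range N, (x + j) ^ (-(s + 1)) ≤
      ∑ j ∈ Finset.range (N + 1), (x + j) ^ (-(s + 1)) := by
    rw [Finset.sum_range_succ]
    have : 0 ≤ (x + N) ^ (-(s + 1)) := by positivity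
    linarith
  have hfirst : x ^ (-(s + 1)) ≤ x ^ (-s) :=
    Real.rpow_le_rpow_of_exponent_le hx (by linarith)
  have hlast : (x ^ (-s) - (x + N) ^ (-s)) / s ≤ 1 / s * x ^ (-s) := by
    rw [one_div_mul_eq_div]
    have : 0 ≤ (x + N) ^ (-s) := by positivity
    gcongr
    linarith
  have hpos : 0 ≤ x ^ (-s) := by positivity
  have h1 := mul_le_mul_of_nonneg_right (le_max_left (1 / s) 1) hpos
  have h2 := mul_le_mul_of_nonneg_right (le_max_right (1 / s) 1) hpos
  linarith [sum_range_rpow_neg_add_one_le hs hx0 N]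

/-- Summation by exchanging the order over the triangle `l ≤ j`. -/
theorem ENNReal.tsum_mul_sum_range_succ (f a : ℕ → ENNReal) :
    ∑' j, f j * ∑ l ∈ Finset.range (j + 1), a l = ∑' l, a l * ∑' m, f (l + m) := by
  have hrow (j : ℕ) : f j * ∑ l ∈ Finset.range (j + 1), a l =
      ∑' l, if l ≤ j then a l * f j else 0 := by
    rw [tsum_eq_sum (s := Finset.range (j + 1)), Finset.mul_sum]
    · refine Finset.sum_congr rfl fun l hl => ?_
      rw [if_pos (by simpa [Nat.lt_succ_iff] using hl), mul_comm]
    · intro l hl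
      rw [if_neg (by simpa [Nat.lt_succ_iff] using hl)]
  simp_rw [hrow]
  rw [ENNReal.tsum_comm]
  refine tsum_congr fun l => ?_
  rw [← ENNReal.summable.sum_add_tsum_nat_add' (k := l), Finset.sum_eq_zero, zero_add,
    ← ENNReal.tsum_mul_left]
  · refine tsum_congr fun m => ?_
    rw [if_pos (by omega), add_comm m l]
  · intro j hj
    rw [if_neg (by simpa using hj)]

theorem sum_Icc_add_le_add_sum_range {a : ℕ → ℝ} (ha : ∀ k, 0 ≤ a k) (n j : ℕ) :
    ∑ i ∈ Finset.Icc 1 (n + j), a i ≤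
      ∑ i ∈ Finset.Icc 1 n, a i + ∑ l ∈ Finset.range (j + 1), a (n + l) := by
  induction j with
  | zero => simpa using ha n
  | succ j ih =>
    rw [← add_assoc, Finset.sum_Icc_succ_top (by omega), Finset.sum_range_succ]
    rw [← add_assoc n j 1]
    linarith


/-- If the non-negative sequence `w` satisfies the `QB_{β,p}` condition with constant `c`, then
`n^{p+βp} Σ_{k=n}^∞ k^{−(p+βp+1)} (Σ_{i=1}^k i^{βp} w(i)) ≤ 2(c+1) max{1/(p+βp),1} Σ_{k=1}^n k^{βp} w(k)`. -/
theorem stmt_15 (p β : ℝ) (hp : 0 < p) (hβ : -1 < β)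
    (w : ℕ → ℝ) (hw : ∀ k, 0 ≤ w k) (c : ℝ) (hc : 0 < c)
    (hQB : ∀ n : ℕ, 1 ≤ n →
      ∑' j : ℕ, ENNReal.ofReal (((n : ℝ) / ((n : ℝ) + j)) ^ p * w (n + j)) ≤
        ENNReal.ofReal (c * ∑ k ∈ Finset.Icc 1 n, ((k : ℝ) / n) ^ (β * p) * w k)) :
    ∀ n : ℕ, 1 ≤ n →
      ENNReal.ofReal ((n : ℝ) ^ (p + β * p)) *
        ∑' j : ℕ, ENNReal.ofReal (((n : ℝ) + j) ^ (-(p + β * p + 1)) *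
          ∑ i ∈ Finset.Icc 1 (n + j), (i : ℝ) ^ (β * p) * w i) ≤
      ENNReal.ofReal (2 * (c + 1) * max (1 / (p + β * p)) 1 *
        ∑ k ∈ Finset.Icc 1 n, (k : ℝ) ^ (β * p) * w k) := by
  intro n hn
  set s := p + β * p with hs_def
  have hs : 0 < s := by nlinarith
  have hn1 : (1 : ℝ) ≤ n := by exact_mod_cast hn
  have hn0 : (0 : ℝ) < n := by linarith
  set M := 2 * max (1 / s) 1 with hM
  have hM0 : 0 ≤ M := by positivity
  set a : ℕ → ℝ := fun i => (i : ℝ) ^ (β * p) * w i with ha_def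
  have ha (k : ℕ) : 0 ≤ a k := mul_nonneg (by positivity) (hw k)
  set S := ∑ k ∈ Finset.Icc 1 n, a k with hS
  have hS0 : 0 ≤ S := Finset.sum_nonneg fun k _ => ha k
  set f : ℕ → ENNReal := fun j => ENNReal.ofReal (((n : ℝ) + j) ^ (-(s + 1))) with hf
  have hsplit : ∑' j : ℕ, ENNReal.ofReal (((n : ℝ) + j) ^ (-(s + 1)) *
        ∑ i ∈ Finset.Icc 1 (n + j), a i) ≤
      (∑' j, f j) * ENNReal.ofReal S +
        ∑' l, ENNReal.ofReal (a (n + l)) * ∑' m, f (l + m) := by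
    rw [← ENNReal.tsum_mul_sum_range_succ f fun l => ENNReal.ofReal (a (n + l)),
      ← ENNReal.tsum_mul_right, ← ENNReal.tsum_add]
    refine ENNReal.tsum_le_tsum fun j => ?_
    rw [ENNReal.ofReal_mul (by positivity), ← mul_add,
      ← ENNReal.ofReal_sum_of_nonneg fun l _ => ha _,
      ← ENNReal.ofReal_add hS0 (Finset.sum_nonneg fun l _ => ha _)]
    gcongr
    exact sum_Icc_add_le_add_sum_range ha n j
  have hhead : ENNReal.ofReal ((n : ℝ) ^ s) * ((∑' j, f j) * ENNReal.ofReal S) ≤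
      ENNReal.ofReal (M * S) := by
    calc _ ≤ ENNReal.ofReal ((n : ℝ) ^ s) *
          (ENNReal.ofReal (M * (n : ℝ) ^ (-s)) * ENNReal.ofReal S) := by
          gcongr
          exact tsum_rpow_neg_add_one_le hs hn1
      _ = ENNReal.ofReal (M * S) := by
          rw [← ENNReal.ofReal_mul (by positivity), ← ENNReal.ofReal_mul (by positivity),
            Real.rpow_neg hn0.le]
          congr 1
          field_simp
  have hterm (l : ℕ) : ENNReal.ofReal ((n : ℝ) ^ s) *
      (ENNReal.ofReal (a (n + l)) * ∑' m, f (l + m)) ≤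
      ENNReal.ofReal (M * (n : ℝ) ^ (β * p)) *
        ENNReal.ofReal (((n : ℝ) / ((n : ℝ) + l)) ^ p * w (n + l)) := by
    have hnl : (0 : ℝ) < n + l := by positivity
    have htail : ∑' m, f (l + m) ≤ ENNReal.ofReal (M * ((n : ℝ) + l) ^ (-s)) := by
      have h := tsum_rpow_neg_add_one_le hs (x := (n : ℝ) + l)
        (by linarith [Nat.cast_nonneg (α := ℝ) l])
      simpa only [hf, Nat.cast_add, add_assoc] using h
    calc _ ≤ ENNReal.ofReal ((n : ℝ) ^ s) * (ENNReal.ofReal (a (n + l)) *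
          ENNReal.ofReal (M * ((n : ℝ) + l) ^ (-s))) := by gcongr
      _ = _ := by
          rw [← ENNReal.ofReal_mul (ha _), ← ENNReal.ofReal_mul (by positivity),
            ← ENNReal.ofReal_mul (by positivity)]
          congr 1
          simp only [ha_def, Nat.cast_add]
          rw [Real.div_rpow hn0.le hnl.le, Real.rpow_neg hnl.le, hs_def,
            Real.rpow_add hn0, Real.rpow_add hnl]
          field_simp
  have hrest : ENNReal.ofReal ((n : ℝ) ^ s) *
      ∑' l, ENNReal.ofReal (a (n + l)) * ∑' m, f (l + m) ≤ ENNReal.ofReal (M * c * S) := by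
    calc _ ≤ ENNReal.ofReal (M * (n : ℝ) ^ (β * p)) *
          ∑' l : ℕ, ENNReal.ofReal (((n : ℝ) / ((n : ℝ) + l)) ^ p * w (n + l)) := by
          rw [← ENNReal.tsum_mul_left, ← ENNReal.tsum_mul_left]
          exact ENNReal.tsum_le_tsum hterm
      _ ≤ ENNReal.ofReal (M * (n : ℝ) ^ (β * p)) *
          ENNReal.ofReal (c * ∑ k ∈ Finset.Icc 1 n, ((k : ℝ) / n) ^ (β * p) * w k) := by
          gcongr
          exact hQB n hn
      _ = _ := by
          have hscale : ∑ k ∈ Finset.Icc 1 n, ((k : ℝ) / n) ^ (β * p) * w k =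
              S / (n : ℝ) ^ (β * p) := by
            rw [hS, Finset.sum_div]
            refine Finset.sum_congr rfl fun k _ => ?_
            rw [Real.div_rpow (Nat.cast_nonneg k) hn0.le, div_mul_eq_mul_div]
          rw [← ENNReal.ofReal_mul (by positivity), hscale]
          congr 1
          field_simp
  calc _ ≤ ENNReal.ofReal ((n : ℝ) ^ s) * ((∑' j, f j) * ENNReal.ofReal S +
        ∑' l, ENNReal.ofReal (a (n + l)) * ∑' m, f (l + m)) := by gcongr
    _ ≤ ENNReal.ofReal (M * S) + ENNReal.ofReal (M * c * S) := by
        rw [mul_add]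
        exact add_le_add hhead hrest
    _ = _ := by
        rw [← ENNReal.ofReal_add (by positivity) (by positivity)]
        congr 1
        rw [hM]
        ring
end

section
/- Let β ≥ 0 and let ψ : ℤ⁺ → ℝ be a non-negative sequence with positive partial sums Ψ(n) = Σ_{τ=1}^{n} ψ(τ) satisfying n^β·Σ_{k=1}^{n} ψ(k) ≤ C·Σ_{k=1}^{n} k^β ψ(k) for all n ∈ ℤ⁺ and some constant C > 0. Then every non-negative sequence y ∈ Q_β satisfies y(n) ≤ (C/Ψ(n))·Σ_{k=1}^{n} y(k) ψ(k) for all n ∈ ℤ⁺. -/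
/-- If the non-negative sequence `ψ` has positive partial sums `Ψ(n) = Σ_{τ=1}^n ψ(τ)` and
satisfies `n^β Σ_{k=1}^n ψ(k) ≤ C Σ_{k=1}^n k^β ψ(k)` for all `n ∈ ℤ⁺`, then every
non-negative quasi non-increasing sequence `y ∈ Q_β` satisfies
`y(n) ≤ (C/Ψ(n)) Σ_{k=1}^n y(k) ψ(k)` for all `n ∈ ℤ⁺`. -/
theorem stmt_19 (β : ℝ) (hβ : 0 ≤ β) (ψ : ℕ → ℝ) (hψ : ∀ k, 0 ≤ ψ k)
    (hΨpos : ∀ n : ℕ, 1 ≤ n → 0 < ∑ τ ∈ Finset.Icc 1 n, ψ τ)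
    (C : ℝ) (hC : 0 < C)
    (h : ∀ n : ℕ, 1 ≤ n →
      (n : ℝ) ^ β * ∑ k ∈ Finset.Icc 1 n, ψ k ≤ C * ∑ k ∈ Finset.Icc 1 n, (k : ℝ) ^ β * ψ k)
    (y : ℕ → ℝ) (hy : ∀ k, 0 ≤ y k)
    (hyQ : ∀ j k : ℕ, 1 ≤ j → j ≤ k → (k : ℝ) ^ (-β) * y k ≤ (j : ℝ) ^ (-β) * y j) :
    ∀ n : ℕ, 1 ≤ n →
      y n ≤ (C / ∑ τ ∈ Finset.Icc 1 n, ψ τ) * ∑ k ∈ Finset.Icc 1 n, y k * ψ k := by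
  intro n hn
  have cancel : ∀ k : ℕ, 1 ≤ k → (k : ℝ) ^ β * ((k : ℝ) ^ (-β) * y k) = y k := by
    intro k hk
    have hk' : (0 : ℝ) < k := by exact_mod_cast hk
    rw [← mul_assoc, ← Real.rpow_add hk', add_neg_cancel, Real.rpow_zero, one_mul]
  have hz : 0 ≤ (n : ℝ) ^ (-β) * y n := mul_nonneg (by positivity) (hy n)
  rw [div_mul_eq_mul_div, le_div_iff₀ (hΨpos n hn)]
  calc y n * ∑ τ ∈ Finset.Icc 1 n, ψ τ
      = ((n : ℝ) ^ (-β) * y n) * ((n : ℝ) ^ β * ∑ τ ∈ Finset.Icc 1 n, ψ τ) := by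
        conv_lhs => rw [← cancel n hn]
        ring
    _ ≤ ((n : ℝ) ^ (-β) * y n) * (C * ∑ k ∈ Finset.Icc 1 n, (k : ℝ) ^ β * ψ k) :=
        mul_le_mul_of_nonneg_left (h n hn) hz
    _ = C * ∑ k ∈ Finset.Icc 1 n, ((n : ℝ) ^ (-β) * y n) * ((k : ℝ) ^ β * ψ k) := by
        rw [← Finset.mul_sum]
        ring
    _ ≤ C * ∑ k ∈ Finset.Icc 1 n, y k * ψ k := by
        refine mul_le_mul_of_nonneg_left (Finset.sum_le_sum fun k hk => ?_) hC.le
        obtain ⟨hk1, hkn⟩ := Finset.mem_Icc.mp hk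
        calc ((n : ℝ) ^ (-β) * y n) * ((k : ℝ) ^ β * ψ k)
            ≤ ((k : ℝ) ^ (-β) * y k) * ((k : ℝ) ^ β * ψ k) :=
              mul_le_mul_of_nonneg_right (hyQ k n hk1 hkn)
                (mul_nonneg (by positivity) (hψ k))
          _ = ((k : ℝ) ^ β * ((k : ℝ) ^ (-β) * y k)) * ψ k := by ring
          _ = y k * ψ k := by rw [cancel k hk1]
end
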